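/- arXiv:1307.7089 — 3 statements merged into one kernel-verified Lean document; each statement's English description precedes it below -/
import Mathlib

section
/- Let G be a finite simple graph on an even number of vertices with a nonnegative weight w(e) on each edge, let M1 be a perfect matching of G, and let C be a 2-matching of G such that no edge of M1 is an edge of C. Then there exists a matching M2 contained in the edge set of C such that the graph with edge set M1 ∪ M2 is an acyclic 2-matching of G and the total weight of M2 is at least one quarter of the total weight of the edges of C. -/
/-- A set of edges is a matching: each edge is non-diagonal (joins two distinct
vertices) and no two distinct edges share a vertex. -/
def IsMatchingSet {V : Type*} (M : Finset (Sym2 V)) : Prop :=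
  (∀ e ∈ M, ¬ e.IsDiag) ∧
    ∀ e ∈ M, ∀ f ∈ M, e ≠ f → ∀ v : V, v ∈ e → v ∉ f

/-- A set of edges is a perfect matching: a matching covering every vertex. -/
def IsPerfectMatchingSet {V : Type*} (M : Finset (Sym2 V)) : Prop :=
  IsMatchingSet M ∧ ∀ v : V, ∃ e ∈ M, v ∈ e

/-- A set of edges is a 2-matching: each edge is non-diagonal and every vertex
is incident to at most two of the edges. -/
def IsTwoMatchingSet {V : Type*} [DecidableEq V] (C : Finset (Sym2 V)) : Prop :=
  (∀ e ∈ C, ¬ e.IsDiag) ∧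
    ∀ v : V, (C.filter (fun e => v ∈ e)).card ≤ 2

/-- A set of edges is an acyclic 2-matching: a 2-matching whose associated graph
contains no cycle, i.e. it is a vertex-disjoint union of paths. -/
def IsAcyclicTwoMatchingSet {V : Type*} [DecidableEq V] (C : Finset (Sym2 V)) : Prop :=
  IsTwoMatchingSet C ∧ (SimpleGraph.fromEdgeSet (↑C : Set (Sym2 V))).IsAcyclic

open SimpleGraph in
/-- In a graph of maximum degree at most two, two paths that leave a common vertex `u` without
returning to its neighbour `t` and that end in leaves have the same end. -/
theorem SimpleGraph.Walk.IsPath.end_eq_of_degree_le_two {V : Type*} {H : SimpleGraph V}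
    (h2 : ∀ y a b c, H.Adj y a → H.Adj y b → H.Adj y c → a = b ∨ a = c ∨ b = c)
    {u v x : V} (p : H.Walk u v) (q : H.Walk u x) (t : V) (ht : H.Adj u t)
    (hp : p.IsPath) (hq : q.IsPath) (htp : t ∉ p.support) (htq : t ∉ q.support)
    (hv : ∀ a b, H.Adj v a → H.Adj v b → a = b)
    (hx : ∀ a b, H.Adj x a → H.Adj x b → a = b) : v = x := by
  induction p generalizing t with
  | nil =>
    cases q with
    | nil => rfl
    | cons h q =>
      have := hv _ _ ht h
      subst this
      simp at htq
  | cons h p ih =>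
    cases q with
    | nil =>
      have := hx _ _ ht h
      subst this
      simp at htp
    | cons h' q =>
      rw [Walk.cons_isPath_iff] at hp hq
      rw [Walk.support_cons, List.mem_cons, not_or] at htp htq
      rcases h2 _ _ _ _ ht h h' with rfl | rfl | rfl
      · simp at htp
      · simp at htq
      · exact ih q _ h.symm hp.1 hq.1 hp.2 hq.2 hv

/-- In a graph of maximum degree at most two, a component contains at most two leaves. -/
theorem SimpleGraph.Reachable.leaf_eq {V : Type*} {H : SimpleGraph V}
    (h2 : ∀ y a b c, H.Adj y a → H.Adj y b → H.Adj y c → a = b ∨ a = c ∨ b = c)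
    {u v x : V} (huv : H.Reachable u v) (hux : H.Reachable u x) (hne : u ≠ v) (hne' : u ≠ x)
    (hu : ∀ a b, H.Adj u a → H.Adj u b → a = b)
    (hv : ∀ a b, H.Adj v a → H.Adj v b → a = b)
    (hx : ∀ a b, H.Adj x a → H.Adj x b → a = b) : v = x := by
  obtain ⟨p, hp⟩ := huv.exists_isPath
  obtain ⟨q, hq⟩ := hux.exists_isPath
  cases p with
  | nil => exact absurd rfl hne
  | cons h p =>
    cases q with
    | nil => exact absurd rfl hne'
    | cons h' q =>
      obtain rfl := hu _ _ h h'
      rw [Walk.cons_isPath_iff] at hp hq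
      exact hp.1.end_eq_of_degree_le_two h2 p q _ h.symm hq.1 hp.2 hq.2 hv hx

theorem IsMatchingSet.right_unique {V : Type*} {M : Finset (Sym2 V)} (hM : IsMatchingSet M)
    {u a b : V} (ha : s(u, a) ∈ M) (hb : s(u, b) ∈ M) : a = b := by
  by_contra hab
  exact hM.2 _ ha _ hb (fun h => hab (Sym2.congr_right.1 h)) u (Sym2.mem_mk_left _ _)
    (Sym2.mem_mk_left _ _)

/-- If neither `u` nor its partner `u'` in the matching `M` is covered by `K`, then the component
of `u` in `M ∪ K` is `{u, u'}`. -/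
theorem IsMatchingSet.eq_or_eq_of_reachable {V : Type*} {M : Finset (Sym2 V)}
    (hM : IsMatchingSet M) {K : Set (Sym2 V)} {u u' v : V} (huu' : s(u, u') ∈ M)
    (hu : ∀ g ∈ K, u ∉ g) (hu' : ∀ g ∈ K, u' ∉ g)
    (h : (SimpleGraph.fromEdgeSet (↑M ∪ K)).Reachable u v) : v = u ∨ v = u' := by
  rw [SimpleGraph.reachable_iff_reflTransGen] at h
  induction h with
  | refl => exact Or.inl rfl
  | tail _ hadj ih =>
    rw [SimpleGraph.fromEdgeSet_adj] at hadj
    rcases ih with rfl | rfl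
    · rcases hadj.1 with h | h
      · exact Or.inr (hM.right_unique h huu')
      · exact absurd (Sym2.mem_mk_left _ _) (hu _ h)
    · rcases hadj.1 with h | h
      · exact Or.inl (hM.right_unique h (Sym2.eq_swap ▸ huu'))
      · exact absurd (Sym2.mem_mk_left _ _) (hu' _ h)

/-- An edge colouring `col` of `C` is proper and every colour class has an acyclic union
with `M`. -/
def IsAcyclicColoring {V ι : Type*} (M C : Finset (Sym2 V)) (col : Sym2 V → ι) : Prop :=
  (∀ e ∈ C, ∀ f ∈ C, e ≠ f → ∀ v, v ∈ e → v ∈ f → col e ≠ col f) ∧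
    ∀ i, (SimpleGraph.fromEdgeSet (↑M ∪ {e | e ∈ C ∧ col e = i})).IsAcyclic

namespace IsAcyclicColoring

variable {V ι : Type*} {M C : Finset (Sym2 V)} {col : Sym2 V → ι}

theorem mono (h : IsAcyclicColoring M C col) {C' : Finset (Sym2 V)} (hC : C' ⊆ C) :
    IsAcyclicColoring M C' col := by
  refine ⟨fun e he f hf => h.1 e (hC he) f (hC hf), fun i => (h.2 i).anti ?_⟩
  exact SimpleGraph.fromEdgeSet_mono (Set.union_subset_union_right _ fun e he => ⟨hC he.1, he.2⟩)

theorem insert [DecidableEq V] (h : IsAcyclicColoring M C col) {u v : V} (he : s(u, v) ∉ C)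
    (i : ι) (hfree : ∀ f ∈ C, u ∈ f ∨ v ∈ f → col f ≠ i)
    (hreach : ¬ (SimpleGraph.fromEdgeSet (↑M ∪ {e | e ∈ C ∧ col e = i})).Reachable u v) :
    IsAcyclicColoring M (insert s(u, v) C) (Function.update col s(u, v) i) := by
  have hne : ∀ f ∈ C, f ≠ s(u, v) := fun f hf h => he (h ▸ hf)
  constructor
  · intro e he f hf hef x hxe hxf
    rcases Finset.mem_insert.1 he with rfl | he <;> rcases Finset.mem_insert.1 hf with rfl | hf
    · exact absurd rfl hef
    · rw [Function.update_self, Function.update_of_ne (hne f hf)]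
      refine (hfree f hf ?_).symm
      rcases Sym2.mem_iff.1 hxe with rfl | rfl
      · exact Or.inl hxf
      · exact Or.inr hxf
    · rw [Function.update_self, Function.update_of_ne (hne e he)]
      refine hfree e he ?_
      rcases Sym2.mem_iff.1 hxf with rfl | rfl
      · exact Or.inl hxe
      · exact Or.inr hxe
    · rw [Function.update_of_ne (hne e he), Function.update_of_ne (hne f hf)]
      exact h.1 e he f hf hef x hxe hxf
  · intro j
    by_cases hj : j = i
    · subst hj
      refine ((h.2 j).sup_edge_of_not_reachable hreach).anti ?_
      rw [SimpleGraph.edge, ← SimpleGraph.fromEdgeSet_union]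
      refine SimpleGraph.fromEdgeSet_mono ?_
      rintro f (hf | ⟨hf, hc⟩)
      · exact Or.inl (Or.inl hf)
      · rcases Finset.mem_insert.1 hf with rfl | hf
        · exact Or.inr rfl
        · rw [Function.update_of_ne (hne f hf)] at hc
          exact Or.inl (Or.inr ⟨hf, hc⟩)
    · refine (h.2 j).anti (SimpleGraph.fromEdgeSet_mono (Set.union_subset_union_right _ ?_))
      rintro f ⟨hf, hc⟩
      rcases Finset.mem_insert.1 hf with rfl | hf
      · rw [Function.update_self] at hc
        exact absurd hc.symm hj
      · rw [Function.update_of_ne (hne f hf)] at hc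
        exact ⟨hf, hc⟩

/-- A colour class of a proper colouring is a matching. -/
theorem eq_of_adj (h : IsAcyclicColoring M C col) {i : ι} {y a b : V}
    (ha : s(y, a) ∈ {e | e ∈ C ∧ col e = i}) (hb : s(y, b) ∈ {e | e ∈ C ∧ col e = i}) :
    a = b := by
  by_contra hab
  exact h.1 _ ha.1 _ hb.1 (fun h => hab (Sym2.congr_right.1 h)) y (Sym2.mem_mk_left _ _)
    (Sym2.mem_mk_left _ _) (ha.2.trans hb.2.symm)

/-- If `u`, `v`, `x` are not covered by the colour `i`, then at most two of them lie in the same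
component of the union of `M` and the colour class `i`. -/
theorem not_reachable (h : IsAcyclicColoring M C col) (hM : IsMatchingSet M) {i : ι} {u v x : V}
    (hu : ∀ f ∈ C, u ∈ f → col f ≠ i) (hv : ∀ f ∈ C, v ∈ f → col f ≠ i)
    (hx : ∀ f ∈ C, x ∈ f → col f ≠ i) (huv : u ≠ v) (hux : u ≠ x) (hvx : v ≠ x)
    (hr : (SimpleGraph.fromEdgeSet (↑M ∪ {e | e ∈ C ∧ col e = i})).Reachable u v) :
    ¬ (SimpleGraph.fromEdgeSet (↑M ∪ {e | e ∈ C ∧ col e = i})).Reachable u x := by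
  have leaf : ∀ y, (∀ f ∈ C, y ∈ f → col f ≠ i) → ∀ a b,
      (SimpleGraph.fromEdgeSet (↑M ∪ {e | e ∈ C ∧ col e = i})).Adj y a →
      (SimpleGraph.fromEdgeSet (↑M ∪ {e | e ∈ C ∧ col e = i})).Adj y b → a = b := by
    intro y hy a b ha hb
    rw [SimpleGraph.fromEdgeSet_adj] at ha hb
    rcases ha.1 with ha | ha
    · rcases hb.1 with hb | hb
      · exact hM.right_unique ha hb
      · exact absurd hb.2 (hy _ hb.1 (Sym2.mem_mk_left _ _))
    · exact absurd ha.2 (hy _ ha.1 (Sym2.mem_mk_left _ _))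
  refine fun hr' => hvx (hr.leaf_eq ?_ hr' huv hux (leaf u hu) (leaf v hv) (leaf x hx))
  intro y a b c ha hb hc
  rw [SimpleGraph.fromEdgeSet_adj] at ha hb hc
  rcases ha.1 with ha | ha <;> rcases hb.1 with hb | hb
  · exact Or.inl (hM.right_unique ha hb)
  · rcases hc.1 with hc | hc
    · exact Or.inr (Or.inl (hM.right_unique ha hc))
    · exact Or.inr (Or.inr (h.eq_of_adj hb hc))
  · rcases hc.1 with hc | hc
    · exact Or.inr (Or.inr (hM.right_unique hb hc))
    · exact Or.inr (Or.inl (h.eq_of_adj ha hc))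
  · exact Or.inl (h.eq_of_adj ha hb)

end IsAcyclicColoring

/-- A 2-matching disjoint from a perfect matching `M` has a proper edge colouring with four colours
each of whose classes has an acyclic union with `M`. -/
theorem IsPerfectMatchingSet.exists_isAcyclicColoring {V : Type*} [DecidableEq V]
    {M : Finset (Sym2 V)} (hM : IsPerfectMatchingSet M)
    (hMa : (SimpleGraph.fromEdgeSet (↑M : Set (Sym2 V))).IsAcyclic)
    (C : Finset (Sym2 V)) (hC : IsTwoMatchingSet C) (hdisj : Disjoint M C) :
    ∃ col : Sym2 V → Fin 4, IsAcyclicColoring M C col := by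
  induction C using Finset.induction_on with
  | empty => exact ⟨fun _ => 0, by simp, fun i => by simpa using hMa⟩
  | insert e C heC ih =>
  induction e using Sym2.ind with
  | h u v =>
  obtain ⟨col, hcol⟩ := ih ⟨fun e he => hC.1 e (Finset.mem_insert_of_mem he), fun y =>
    (Finset.card_le_card (Finset.filter_subset_filter _ (Finset.subset_insert _ _))).trans
      (hC.2 y)⟩ (hdisj.mono_right (Finset.subset_insert _ _))
  by_cases hfree : ∃ i, (∀ f ∈ C, u ∈ f ∨ v ∈ f → col f ≠ i) ∧
      ¬ (SimpleGraph.fromEdgeSet (↑M ∪ {e | e ∈ C ∧ col e = i})).Reachable u v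
  · obtain ⟨i, hi, hr⟩ := hfree
    exact ⟨_, hcol.insert heC i hi hr⟩
  have hblock : ∀ i, (∀ f ∈ C, u ∈ f ∨ v ∈ f → col f ≠ i) →
      (SimpleGraph.fromEdgeSet (↑M ∪ {e | e ∈ C ∧ col e = i})).Reachable u v := by
    intro i hi
    by_contra hr
    exact hfree ⟨i, hi, hr⟩
  have huv : u ≠ v := fun h => hC.1 _ (Finset.mem_insert_self _ _) (by simpa using h)
  obtain ⟨u', huu'⟩ : ∃ u', s(u, u') ∈ M := by
    obtain ⟨g, hg, hug⟩ := hM.2 u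
    obtain ⟨u', rfl⟩ := hug
    exact ⟨u', hg⟩
  have hvu' : v ≠ u' := by
    rintro rfl
    exact Finset.disjoint_left.1 hdisj huu' (Finset.mem_insert_self _ _)
  let cols : V → Finset (Fin 4) := fun y => (C.filter (y ∈ ·)).image col
  have mem_cols : ∀ y i, i ∈ cols y ↔ ∃ f ∈ C, y ∈ f ∧ col f = i := by
    intro y i
    simp [cols, and_assoc]
  have not_mem_cols : ∀ {y i}, i ∉ cols y → ∀ f ∈ C, y ∈ f → col f ≠ i :=
    fun {y i} hi f hf hy hc => hi ((mem_cols y i).2 ⟨f, hf, hy, hc⟩)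
  have cols_le_two : ∀ y, (cols y).card ≤ 2 := fun y =>
    Finset.card_image_le.trans ((Finset.card_le_card
      (Finset.filter_subset_filter _ (Finset.subset_insert _ _))).trans (hC.2 y))
  have degree_le_one : ∀ y ∈ s(u, v), (C.filter (y ∈ ·)).card ≤ 1 := by
    intro y hy
    have h := hC.2 y
    rw [Finset.filter_insert, if_pos hy, Finset.card_insert_of_notMem
      (fun h => heC (Finset.mem_filter.1 h).1)] at h
    omega
  have hu1 : (cols u).card ≤ 1 := Finset.card_image_le.trans (degree_le_one u (by simp))
  have hv1 : (cols v).card ≤ 1 := Finset.card_image_le.trans (degree_le_one v (by simp))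
  -- One colour at `u`, one at `v` and two at the partner of `u` exhaust all four colours.
  have hcover : ∀ i, i ∉ cols u → i ∉ cols v → i ∈ cols u' := by
    intro i hiu hiv
    by_contra hiu'
    have hr := hblock i (fun f hf => fun h => h.elim (not_mem_cols hiu f hf)
      (not_mem_cols hiv f hf))
    rcases hM.1.eq_or_eq_of_reachable huu' (fun g hg h => not_mem_cols hiu g hg.1 h hg.2)
      (fun g hg h => not_mem_cols hiu' g hg.1 h hg.2) hr with h | h
    · exact huv h.symm
    · exact hvu' h
  have hunion : cols u ∪ (cols v ∪ cols u') = Finset.univ := by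
    ext i
    have := hcover i
    simp only [Finset.mem_union, Finset.mem_univ, iff_true]
    tauto
  have hcard : (cols u ∪ (cols v ∪ cols u')).card = 4 := by rw [hunion]; rfl
  have h1 := Finset.card_union_add_card_inter (cols u) (cols v ∪ cols u')
  have h2 := Finset.card_union_add_card_inter (cols v) (cols u')
  have hu'2 := cols_le_two u'
  have hdu : Disjoint (cols u) (cols v ∪ cols u') := by
    rw [Finset.disjoint_iff_inter_eq_empty, ← Finset.card_eq_zero]
    omega
  have hdv : Disjoint (cols v) (cols u') := by
    rw [Finset.disjoint_iff_inter_eq_empty, ← Finset.card_eq_zero]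
    omega
  obtain ⟨a, hau⟩ : (cols u).Nonempty := by
    rw [← Finset.card_pos]
    omega
  have hav : a ∉ cols v := fun h => Finset.disjoint_left.1 hdu hau (Finset.mem_union_left _ h)
  have hau' : a ∉ cols u' := fun h => Finset.disjoint_left.1 hdu hau (Finset.mem_union_right _ h)
  obtain ⟨f, hfC, ⟨x, rfl⟩, hfa⟩ := (mem_cols u a).1 hau
  have hax : a ∈ cols x := (mem_cols x a).2 ⟨_, hfC, Sym2.mem_mk_right _ _, hfa⟩
  obtain ⟨i, hiu', hix⟩ : ∃ i ∈ cols u', i ∉ (cols x).erase a := by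
    refine Finset.exists_mem_notMem_of_card_lt_card ?_
    have := cols_le_two x
    rw [Finset.card_erase_of_mem hax]
    omega
  have hia : i ≠ a := fun h => hau' (h ▸ hiu')
  have hix : i ∉ cols x := fun h => hix (Finset.mem_erase.2 ⟨hia, h⟩)
  have hiu : i ∉ cols u := fun h => Finset.disjoint_left.1 hdu h (Finset.mem_union_right _ hiu')
  have hiv : i ∉ cols v := fun h => Finset.disjoint_left.1 hdv h hiu'
  have hux : u ≠ x := fun h => hC.1 _ (Finset.mem_insert_of_mem hfC) (by simpa using h)
  have hvx : v ≠ x := by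
    rintro rfl
    exact heC hfC
  have hnr := hcol.not_reachable hM.1 (not_mem_cols hiu) (not_mem_cols hiv) (not_mem_cols hix)
    huv hux hvx (hblock i fun f hf => fun h => h.elim (not_mem_cols hiu f hf)
      (not_mem_cols hiv f hf))
  -- Recolour the edge `s(u, x)` with `i`, which makes its old colour `a` available at `u`.
  have hcol' := (hcol.mono (Finset.erase_subset s(u, x) C)).insert (Finset.notMem_erase _ _) i
    (fun f hf h => h.elim (not_mem_cols hiu f (Finset.mem_of_mem_erase hf))
      (not_mem_cols hix f (Finset.mem_of_mem_erase hf)))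
    (fun h => hnr (h.mono (SimpleGraph.fromEdgeSet_mono (Set.union_subset_union_right _
      fun e he => ⟨Finset.mem_of_mem_erase he.1, he.2⟩))))
  rw [Finset.insert_erase hfC] at hcol'
  have hfree_of : ∀ y, a ∉ cols y →
      ∀ g ∈ C, y ∈ g → Function.update col s(u, x) i g ≠ a := by
    intro y hy g hg hyg
    by_cases hgf : g = s(u, x)
    · rw [hgf, Function.update_self]
      exact hia
    · rw [Function.update_of_ne hgf]
      exact not_mem_cols hy g hg hyg
  have hfree_u : ∀ g ∈ C, u ∈ g → Function.update col s(u, x) i g ≠ a := by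
    intro g hg hug
    have hgf : g = s(u, x) := Finset.card_le_one.1 (degree_le_one u (by simp)) g
      (Finset.mem_filter.2 ⟨hg, hug⟩) _ (Finset.mem_filter.2 ⟨hfC, Sym2.mem_mk_left _ _⟩)
    rw [hgf, Function.update_self]
    exact hia
  refine ⟨_, hcol'.insert heC a (fun g hg h => h.elim (hfree_u g hg) (hfree_of v hav g hg)) ?_⟩
  intro hr
  rcases hM.1.eq_or_eq_of_reachable huu' (fun g hg h => hfree_u g hg.1 h hg.2)
    (fun g hg h => hfree_of u' hau' g hg.1 h hg.2) hr with h | h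
  · exact huv h.symm
  · exact hvu' h

theorem IsMatchingSet.card_filter_le_one {V : Type*} [DecidableEq V] {M : Finset (Sym2 V)}
    (hM : IsMatchingSet M) (v : V) : (M.filter (v ∈ ·)).card ≤ 1 := by
  refine Finset.card_le_one.2 fun e he f hf => ?_
  rw [Finset.mem_filter] at he hf
  by_contra hef
  exact hM.2 e he.1 f hf.1 hef v he.2 hf.2

theorem IsMatchingSet.isAcyclic {V : Type*} {M : Finset (Sym2 V)} (hM : IsMatchingSet M) :
    (SimpleGraph.fromEdgeSet (↑M : Set (Sym2 V))).IsAcyclic := by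
  intro v p hp
  have hs := hp.snd_ne_penultimate
  have h1 := p.adj_snd hp.not_nil
  have h2 := (p.adj_penultimate hp.not_nil).symm
  rw [SimpleGraph.fromEdgeSet_adj] at h1 h2
  exact hs (hM.right_unique h1.1 h2.1)

/-- If `M1` is a perfect matching of a finite edge-weighted simple graph `G`
on an even number of vertices (with nonnegative edge weights) and `C` is a 2-matching of
`G` sharing no edge with `M1`, then there is a matching `M2 ⊆ C` such that `M1 ∪ M2` is an
acyclic 2-matching of `G` and the weight of `M2` is at least a quarter of the weight of `C`. -/
theorem stmt2 {V : Type*} [Fintype V] [DecidableEq V]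
    (hV : Even (Fintype.card V)) (G : SimpleGraph V)
    (w : Sym2 V → ℝ) (hw : ∀ e, 0 ≤ w e)
    (M1 : Finset (Sym2 V)) (hM1 : IsPerfectMatchingSet M1)
    (hM1G : (↑M1 : Set (Sym2 V)) ⊆ G.edgeSet)
    (C : Finset (Sym2 V)) (hC : IsTwoMatchingSet C)
    (hCG : (↑C : Set (Sym2 V)) ⊆ G.edgeSet)
    (hdisj : Disjoint M1 C) :
    ∃ M2 ⊆ C, IsMatchingSet M2 ∧
      (↑(M1 ∪ M2) : Set (Sym2 V)) ⊆ G.edgeSet ∧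
      IsAcyclicTwoMatchingSet (M1 ∪ M2) ∧
      (1 / 4 : ℝ) * ∑ e ∈ C, w e ≤ ∑ e ∈ M2, w e := by
  obtain ⟨col, hcol⟩ := hM1.exists_isAcyclicColoring hM1.1.isAcyclic C hC hdisj
  obtain ⟨i, -, hi⟩ : ∃ i ∈ (Finset.univ : Finset (Fin 4)),
      (1 / 4 : ℝ) * ∑ e ∈ C, w e ≤ ∑ e ∈ C with col e = i, w e := by
    refine Finset.exists_le_of_sum_le Finset.univ_nonempty ?_
    rw [Finset.sum_fiberwise]
    simp only [Finset.sum_const, Finset.card_univ, Fintype.card_fin, nsmul_eq_mul]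
    push_cast
    linarith
  have hsub : C.filter (col · = i) ⊆ C := Finset.filter_subset _ _
  have hM2 : IsMatchingSet (C.filter (col · = i)) := by
    refine ⟨fun e he => hC.1 e (hsub he), fun e he f hf hef v hve hvf => ?_⟩
    rw [Finset.mem_filter] at he hf
    exact hcol.1 e he.1 f hf.1 hef v hve hvf (he.2.trans hf.2.symm)
  refine ⟨C.filter (col · = i), hsub, hM2, ?_, ⟨⟨?_, fun v => ?_⟩, ?_⟩, hi⟩
  · rw [Finset.coe_union]
    exact Set.union_subset hM1G ((Finset.coe_subset.2 hsub).trans hCG)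
  · intro e he
    exact (Finset.mem_union.1 he).elim (hM1.1.1 e) (hM2.1 e)
  · rw [Finset.filter_union]
    exact (Finset.card_union_le _ _).trans
      (add_le_add (hM1.1.card_filter_le_one v) (hM2.card_filter_le_one v))
  · rw [Finset.coe_union, Finset.coe_filter]
    exact hcol.2 i
end

section
/- Let G be a finite simple graph on an even number of vertices with a nonnegative weight w(e) on each edge, let M1 be a perfect matching of G, and let C1 and C2 be two 2-matchings of G that are edge-disjoint from each other and such that no edge of M1 is an edge of C1 or of C2. Then there exists a matching M2 contained in the union of the edge sets of C1 and C2 such that the graph with edge set M1 ∪ M2 is an acyclic 2-matching of G and the total weight of M2 is at least 2/15 of the sum of the total weights of the edges of C1 and C2 (i.e., at least a 1/7.5 fraction of that total weight). -/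
section
open Finset

/-- The involution `π` describes path ends; `upd π a b` describes the path ends after joining
the paths ending in `a` and `b` by the edge `ab`. -/
def upd {V : Type*} [DecidableEq V] (π : V → V) (a b v : V) : V :=
  if v = a then b else if v = b then a else if v = π a then π b
  else if v = π b then π a else π v

/-- The weights of the edges that stay available after choosing the edge `ab`. -/
def cut {V : Type*} [DecidableEq V] (c : V → V → ℝ) (π : V → V) (a b u v : V) : ℝ :=
  if u = a ∨ u = b ∨ v = a ∨ v = b ∨ (u = π a ∧ v = π b) ∨ (u = π b ∧ v = π a) then 0
  else c u v

/-- A weighted graph of maximum degree at most four, together with a fixed point free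
involution which never joins adjacent vertices. -/
structure Inst {V : Type*} [Fintype V] (π : V → V) (c : V → V → ℝ) : Prop where
  inv : ∀ v, π (π v) = v
  ne : ∀ v, π v ≠ v
  symm : ∀ u v, c u v = c v u
  nonneg : ∀ u v, 0 ≤ c u v
  diag : ∀ v, c v v = 0
  part : ∀ v, c v (π v) = 0
  deg : ∀ v, #{u | c v u ≠ 0} ≤ 4

/-- The sequences of edges that can be chosen one after another. -/
inductive Picks {V : Type*} [DecidableEq V] : (V → V) → List (V × V) → Prop
  | nil (π : V → V) : Picks π []
  | cons (π : V → V) (a b : V) (l : List (V × V)) (hab : a ≠ b) (hπ : π a ≠ b)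
      (hl : ∀ p ∈ l, p.1 ≠ a ∧ p.1 ≠ b ∧ p.2 ≠ a ∧ p.2 ≠ b) (h : Picks (upd π a b) l) :
      Picks π ((a, b) :: l)

/-- The weight `s` can be attained by a sequence of choices. -/
def Attains {V : Type*} [DecidableEq V] (π : V → V) (c : V → V → ℝ) (s : ℝ) : Prop :=
  ∃ l : List (V × V), Picks π l ∧ (∀ p ∈ l, c p.1 p.2 ≠ 0) ∧
    s ≤ (l.map fun p => c p.1 p.2).sum

section
variable {V : Type*} [DecidableEq V] {π : V → V} {c : V → V → ℝ} {a b : V}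

lemma upd_upd (hinv : ∀ v, π (π v) = v) (hne : ∀ v, π v ≠ v) (hab : a ≠ b) (hπ : π a ≠ b)
    (v : V) : upd π a b (upd π a b v) = v := by
  unfold upd
  grind

lemma upd_ne (hinv : ∀ v, π (π v) = v) (hne : ∀ v, π v ≠ v) (hab : a ≠ b) (v : V) :
    upd π a b v ≠ v := by
  unfold upd
  grind

lemma cut_of_ne_zero {u v : V} (h : cut c π a b u v ≠ 0) :
    u ≠ a ∧ u ≠ b ∧ v ≠ a ∧ v ≠ b ∧ cut c π a b u v = c u v := by
  unfold cut at h ⊢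
  split_ifs at h ⊢ with h'
  · exact absurd rfl h
  · push Not at h'
    exact ⟨h'.1, h'.2.1, h'.2.2.1, h'.2.2.2.1, rfl⟩

variable [Fintype V]

omit [DecidableEq V] in
lemma Inst.ne_of_ne_zero (H : Inst π c) {a b : V} (h : c a b ≠ 0) : a ≠ b ∧ π a ≠ b := by
  constructor
  · rintro rfl; exact h (H.diag a)
  · rintro rfl; exact h (H.part a)

lemma Inst.cut_le (H : Inst π c) (u v : V) : cut c π a b u v ≤ c u v := by
  unfold cut
  split_ifs
  · exact H.nonneg u v
  · exact le_rfl

lemma Inst.cut_nonneg (H : Inst π c) (u v : V) : 0 ≤ cut c π a b u v := by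
  unfold cut
  split_ifs
  · exact le_rfl
  · exact H.nonneg u v

lemma Inst.choose (H : Inst π c) (hab : a ≠ b) (hπ : π a ≠ b) :
    Inst (upd π a b) (cut c π a b) where
  inv := upd_upd H.inv H.ne hab hπ
  ne := upd_ne H.inv H.ne hab
  symm u v := by
    have := H.symm u v
    unfold cut
    grind
  nonneg := H.cut_nonneg
  diag v := le_antisymm ((H.cut_le v v).trans (H.diag v).le) (H.cut_nonneg v v)
  part v := by
    have := H.inv
    have := H.part v
    unfold upd cut
    grind
  deg v := by
    refine (card_le_card fun u hu => ?_).trans (H.deg v)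
    simp only [mem_filter, mem_univ, true_and] at hu ⊢
    exact fun h => hu (le_antisymm ((H.cut_le v u).trans h.le) (H.cut_nonneg v u))

lemma Attains.cons {s : ℝ} (H : Inst π c) (hab : c a b ≠ 0)
    (h : Attains (upd π a b) (cut c π a b) s) : Attains π c (c a b + s) := by
  obtain ⟨l, hl, hc, hs⟩ := h
  have key := fun p hp => cut_of_ne_zero (hc p hp)
  refine ⟨(a, b) :: l, .cons π a b l (H.ne_of_ne_zero hab).1 (H.ne_of_ne_zero hab).2
    (fun p hp => ⟨(key p hp).1, (key p hp).2.1, (key p hp).2.2.1, (key p hp).2.2.2.1⟩) hl,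
    ?_, ?_⟩
  · simp only [List.mem_cons, forall_eq_or_imp]
    exact ⟨hab, fun p hp => (key p hp).2.2.2.2 ▸ hc p hp⟩
  · rw [List.map_congr_left fun p hp => (key p hp).2.2.2.2] at hs
    simpa using hs

lemma card_support_cut_lt (hab : c a b ≠ 0) :
    #{p : V × V | cut c π a b p.1 p.2 ≠ 0} < #{p : V × V | c p.1 p.2 ≠ 0} := by
  refine card_lt_card ⟨fun p hp => ?_, fun h => ?_⟩
  · simp only [mem_filter, mem_univ, true_and] at hp ⊢
    exact (cut_of_ne_zero hp).2.2.2.2 ▸ hp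
  · have := @h (a, b) (by simpa using hab)
    simp [cut] at this

/-- A row of the weight matrix loses at least the entries which are cut. -/
lemma Inst.row_cut_le (H : Inst π c) (v : V) (T : Finset V)
    (hT : ∀ u ∈ T, cut c π a b v u = 0) :
    ∑ u, cut c π a b v u ≤ ∑ u, c v u - ∑ u ∈ T, c v u := by
  have h := sum_le_sum fun u (_ : u ∈ univ \ T) => H.cut_le (a := a) (b := b) v u
  have h1 := sum_sdiff (subset_univ T) (f := cut c π a b v)
  have h2 := sum_sdiff (subset_univ T) (f := c v)
  rw [sum_eq_zero hT] at h1
  linarith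

/-- The amount of weight which is destroyed by choosing the edge `ab`. -/
def kill (π : V → V) (c : V → V → ℝ) (a b : V) : ℝ :=
  ∑ u, c a u + ∑ u, c b u - c a b + c (π a) (π b)

lemma Inst.sum_le_sum_cut (H : Inst π c) (hab : a ≠ b) (hπ : π a ≠ b) :
    ∑ u, ∑ v, c u v ≤ ∑ u, ∑ v, cut c π a b u v + 2 * kill π c a b := by
  have hs := H.symm
  have key : ∀ u v, c u v ≤ cut c π a b u v + ((if u = a then c a v else 0)
      + (if u = b then c b v else 0) + (if v = a then c a u else 0)
      + (if v = b then c b u else 0)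
      - (if u = a then if v = b then c a b else 0 else 0)
      - (if u = b then if v = a then c a b else 0 else 0)
      + (if u = π a then if v = π b then c (π a) (π b) else 0 else 0)
      + (if u = π b then if v = π a then c (π a) (π b) else 0 else 0)) := by
    intro u v
    have h1 := H.diag a
    have h2 := H.diag b
    have h3 := H.part a
    have h4 := H.part b
    have h5 := H.nonneg a b
    have h6 := H.nonneg u v
    have h7 := H.nonneg (π a) (π b)
    have h8 := H.nonneg b a
    have h9 := hs a b
    have h10 := hs (π a) (π b)
    have h11 := hs a u
    have h12 := hs b u
    have := H.inv
    unfold cut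
    split_ifs <;> grind
  have := sum_le_sum fun u (_ : u ∈ univ) => sum_le_sum fun v (_ : v ∈ univ) => key u v
  refine this.trans (le_of_eq ?_)
  simp only [sum_add_distrib, sum_sub_distrib, sum_ite_eq', mem_univ, if_true, sum_ite_irrel,
    sum_const_zero]
  unfold kill
  ring

end

/-- A smallest instance in which a fifteenth of the entry sum is not attained. -/
structure MinimalBad {V : Type*} [Fintype V] [DecidableEq V] (π : V → V) (c : V → V → ℝ) :
    Prop extends Inst π c where
  ih : ∀ (π' : V → V) (c' : V → V → ℝ), Inst π' c' →
    #{p : V × V | c' p.1 p.2 ≠ 0} < #{p : V × V | c p.1 p.2 ≠ 0} →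
    Attains π' c' ((∑ u, ∑ v, c' u v) / 15)
  bad : ¬ Attains π c ((∑ u, ∑ v, c u v) / 15)

section
variable {V : Type*} [DecidableEq V] {π : V → V} {c : V → V → ℝ} {a b : V} [Fintype V]

omit [DecidableEq V] in
lemma Inst.row_le (H : Inst π c) (v : V) (K : Finset V) (hK : ∀ u ∈ K, c v u ≠ 0) {γ : ℝ}
    (hγ0 : 0 ≤ γ) (hγ : ∀ u ∉ K, c v u ≤ γ) :
    ∑ u, c v u ≤ ∑ u ∈ K, c v u + (4 - #K) * γ := by
  classical
  have hKN : K ⊆ ({u | c v u ≠ 0} : Finset V) := fun u hu => by simpa using hK u hu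
  have h1 : ∑ u, c v u = ∑ u ∈ ({u | c v u ≠ 0} : Finset V), c v u :=
    (sum_filter_ne_zero univ).symm
  rw [h1, ← sum_sdiff hKN, add_comm]
  gcongr
  refine (sum_le_card_nsmul _ _ γ fun u hu => hγ u (mem_sdiff.1 hu).2).trans ?_
  rw [nsmul_eq_mul]
  gcongr
  have h2 := card_sdiff_add_card_eq_card hKN
  have h3 := H.deg v
  have h4 : (#(({u | c v u ≠ 0} : Finset V) \ K) : ℝ) + #K ≤ 4 := by
    exact_mod_cast h2.trans_le h3
  linarith

omit [DecidableEq V] in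
lemma Inst.row_le_one (H : Inst π c) {v u : V} (hu : c v u ≠ 0) {γ : ℝ}
    (hγ0 : 0 ≤ γ) (hγ : ∀ x, x ≠ u → c v x ≤ γ) :
    ∑ u, c v u ≤ c v u + 3 * γ := by
  have := H.row_le v {u} (by simpa using hu) hγ0 (by simpa using hγ)
  simp only [sum_singleton, card_singleton] at this
  push_cast at this
  linarith

omit [DecidableEq V] in
lemma Inst.row_le_two (H : Inst π c) {v u x : V} (hux : u ≠ x) (hu : c v u ≠ 0)
    (hx : c v x ≠ 0) {γ : ℝ} (hγ0 : 0 ≤ γ) (hγ : ∀ y, y ≠ u → y ≠ x → c v y ≤ γ) :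
    ∑ u, c v u ≤ c v u + c v x + 2 * γ := by
  classical
  have := H.row_le v {u, x} (by simpa using ⟨hu, hx⟩) hγ0 (by simpa using hγ)
  rw [sum_pair hux, card_pair hux] at this
  push_cast at this
  linarith

omit [DecidableEq V] in
lemma Inst.row_le_three (H : Inst π c) {v u x y : V} (hux : u ≠ x) (huy : u ≠ y) (hxy : x ≠ y)
    (hu : c v u ≠ 0) (hx : c v x ≠ 0) (hy : c v y ≠ 0) {γ : ℝ} (hγ : ∀ t, c v t ≤ γ) :
    ∑ u, c v u ≤ c v u + c v x + c v y + γ := by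
  classical
  have := H.row_le v {u, x, y} (by simpa using ⟨hu, hx, hy⟩) ((H.nonneg v u).trans (hγ u))
    fun t _ => hγ t
  rw [sum_insert (by simp [hux, huy]), card_insert_of_notMem (by simp [hux, huy]),
    sum_pair hxy, card_pair hxy] at this
  push_cast at this
  linarith

lemma MinimalBad.lt_of_attains (B : MinimalBad π c) (h : c a b ≠ 0) {s : ℝ}
    (hs : Attains (upd π a b) (cut c π a b) s) : c a b + s < (∑ u, ∑ v, c u v) / 15 := by
  by_contra hlt
  obtain ⟨l, h1, h2, h3⟩ := hs.cons B.toInst h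
  exact B.bad ⟨l, h1, h2, (not_lt.1 hlt).trans h3⟩

lemma MinimalBad.lt_one (B : MinimalBad π c) (h : c a b ≠ 0) :
    7.5 * c a b < kill π c a b := by
  have hab := B.ne_of_ne_zero h
  have h1 := B.lt_of_attains h (B.ih _ _ (B.choose hab.1 hab.2) (card_support_cut_lt h))
  have h2 := B.sum_le_sum_cut hab.1 hab.2
  linarith

lemma MinimalBad.lt_two (B : MinimalBad π c) (h : c a b ≠ 0) {u v : V}
    (h' : cut c π a b u v ≠ 0) :
    7.5 * (c a b + cut c π a b u v) <
      kill π c a b + kill (upd π a b) (cut c π a b) u v := by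
  have hab := B.ne_of_ne_zero h
  have I₁ := B.choose hab.1 hab.2
  have huv := I₁.ne_of_ne_zero h'
  have h1 := B.lt_of_attains h (Attains.cons I₁ h' (B.ih _ _ (I₁.choose huv.1 huv.2)
    ((card_support_cut_lt h').trans (card_support_cut_lt h))))
  have h2 := B.sum_le_sum_cut hab.1 hab.2
  have h3 := I₁.sum_le_sum_cut huv.1 huv.2
  linarith

lemma MinimalBad.lt_three (B : MinimalBad π c) (h : c a b ≠ 0) {u v x y : V}
    (h' : cut c π a b u v ≠ 0) (h'' : cut (cut c π a b) (upd π a b) u v x y ≠ 0) :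
    7.5 * (c a b + cut c π a b u v + cut (cut c π a b) (upd π a b) u v x y) <
      kill π c a b + kill (upd π a b) (cut c π a b) u v +
        kill (upd (upd π a b) u v) (cut (cut c π a b) (upd π a b) u v) x y := by
  have hab := B.ne_of_ne_zero h
  have I₁ := B.choose hab.1 hab.2
  have huv := I₁.ne_of_ne_zero h'
  have I₂ := I₁.choose huv.1 huv.2
  have hxy := I₂.ne_of_ne_zero h''
  have h1 := B.lt_of_attains h (Attains.cons I₁ h' (Attains.cons I₂ h''
    (B.ih _ _ (I₂.choose hxy.1 hxy.2) ((card_support_cut_lt h'').trans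
      ((card_support_cut_lt h').trans (card_support_cut_lt h))))))
  have h2 := B.sum_le_sum_cut hab.1 hab.2
  have h3 := I₁.sum_le_sum_cut huv.1 huv.2
  have h4 := I₂.sum_le_sum_cut hxy.1 hxy.2
  linarith

omit [DecidableEq V] in
lemma Inst.row_sub_le (H : Inst π c) {m : ℝ} (hm : ∀ u v, c u v ≤ m) {u v : V}
    (h : c u v ≠ 0) : ∑ x, c v x - c u v ≤ 3 * m := by
  have := H.row_le_one (v := v) (u := u) (by rwa [H.symm]) ((H.nonneg u v).trans (hm u v))
    (fun x _ => hm v x)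
  rw [H.symm v u] at this
  linarith

lemma Inst.row_cut_le_two (H : Inst π c) {v x y : V} (hxy : x ≠ y)
    (hx : cut c π a b v x = 0) (hy : cut c π a b v y = 0) :
    ∑ u, cut c π a b v u ≤ ∑ u, c v u - (c v x + c v y) := by
  have := H.row_cut_le (a := a) (b := b) v {x, y} (by simpa using ⟨hx, hy⟩)
  rwa [sum_pair hxy] at this

lemma MinimalBad.lt_triple (B : MinimalBad π c) {m : ℝ} (hm : ∀ u v, c u v ≤ m) {x y : V}
    (hab : a ≠ b) (hab' : π a ≠ b) (hf : c (π a) (π b) ≠ 0)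
    (hx : c a x ≠ 0) (hy : c b y ≠ 0) (hxb : x ≠ b) (hxb' : x ≠ π b)
    (hya : y ≠ a) (hya' : y ≠ π a) (hxy : y ≠ x) (hxy' : y ≠ π x) :
    7.5 * (c (π a) (π b) + c a x + c b y) <
      ∑ u, c (π a) u + ∑ u, c (π b) u - c (π a) (π b) + (∑ u, c a u - c a (π b)) +
        (∑ u, c b u - c a b - c b (π a) - c b x) + 7 * m := by
  have hinv := B.inv
  have hne := B.ne
  have hxa := B.ne_of_ne_zero hx
  have hyb := B.ne_of_ne_zero hy
  have I₁ := B.choose (B.ne_of_ne_zero hf).1 (B.ne_of_ne_zero hf).2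
  have e1 : cut c π (π a) (π b) a x = c a x := by
    unfold cut; rw [if_neg]; grind
  have e2 : cut (cut c π (π a) (π b)) (upd π (π a) (π b)) a x b y = c b y := by
    unfold cut upd; grind
  have hx1 : cut c π (π a) (π b) a x ≠ 0 := by rwa [e1]
  have hy2 : cut (cut c π (π a) (π b)) (upd π (π a) (π b)) a x b y ≠ 0 := by rwa [e2]
  have I₂ := I₁.choose (I₁.ne_of_ne_zero hx1).1 (I₁.ne_of_ne_zero hx1).2
  have key := B.lt_three hf hx1 hy2
  have hm1 : ∀ u v, cut c π (π a) (π b) u v ≤ m := fun u v => (B.cut_le u v).trans (hm u v)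
  have hm2 : ∀ u v, cut (cut c π (π a) (π b)) (upd π (π a) (π b)) a x u v ≤ m :=
    fun u v => (I₁.cut_le u v).trans (hm1 u v)
  have r1 := I₁.row_sub_le hm1 hx1
  have r2 := I₂.row_sub_le hm2 hy2
  have k1 : cut c π (π a) (π b) b x = c b x := by
    unfold cut; rw [if_neg]; grind
  have u1 : upd π (π a) (π b) a = b := by unfold upd; grind
  have u2 : upd π (π a) (π b) x = π x := by unfold upd; grind
  have d1 := B.row_cut_le_two (a := π a) (b := π b) (v := a) (x := π b) (y := b)
    (hne b) (by unfold cut; grind) (by unfold cut; grind)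
  have d2 := B.row_cut_le_two (a := π a) (b := π b) (v := b) (x := π a) (y := a)
    (hne a) (by unfold cut; grind) (by unfold cut; grind)
  have d3 := I₁.row_cut_le_two (a := a) (b := x) (v := b) (x := x) (y := π x)
    (hne x).symm (by unfold cut; grind) (by unfold cut; grind)
  have s1 := B.symm a b
  have cl := hm2 (upd (upd π (π a) (π b)) a x b) (upd (upd π (π a) (π b)) a x y)
  simp only [kill, e1, e2, hinv, u1, u2] at key r1 r2 cl
  linarith

/-- Choosing `ab` first and then an edge at the other end `π a`. -/
lemma MinimalBad.lt_extend (B : MinimalBad π c) {m : ℝ} (hm : ∀ u v, c u v ≤ m) {z : V}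
    (hab : c a b ≠ 0) (hz : c (π a) z ≠ 0) (hza : z ≠ a) (hzb : z ≠ b) (hzb' : z ≠ π b) :
    7.5 * (c a b + c (π a) z) <
      ∑ u, c a u + ∑ u, c b u - c a b + (∑ u, c (π a) u - c (π a) b) + 3 * m +
        c (π b) (π z) := by
  have hinv := B.inv
  have hne := B.ne
  have hab' := B.ne_of_ne_zero hab
  have hz' := B.ne_of_ne_zero hz
  have I₁ := B.choose hab'.1 hab'.2
  have e1 : cut c π a b (π a) z = c (π a) z := by
    unfold cut; rw [if_neg]; grind
  have hz1 : cut c π a b (π a) z ≠ 0 := by rwa [e1]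
  have key := B.lt_two hab hz1
  have hm1 : ∀ u v, cut c π a b u v ≤ m := fun u v => (B.cut_le u v).trans (hm u v)
  have r1 := I₁.row_sub_le hm1 hz1
  have u1 : upd π a b (π a) = π b := by unfold upd; grind
  have u2 : upd π a b z = π z := by unfold upd; grind
  have d1 := B.row_cut_le_two (a := a) (b := b) (v := π a) (x := b) (y := π b)
    (hne b).symm (by unfold cut; grind) (by unfold cut; grind)
  have cl := B.cut_le (a := a) (b := b) (π b) (π z)
  simp only [kill, e1, u1, u2] at key r1 cl
  linarith

/-- Choosing an edge `ax` and then an edge `by`, where `x` and `y` are unrelated. -/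
lemma MinimalBad.lt_pair (B : MinimalBad π c) {m : ℝ} (hm : ∀ u v, c u v ≤ m) {x y : V}
    (hab : a ≠ b) (hab' : π a ≠ b) (hx : c a x ≠ 0) (hy : c b y ≠ 0)
    (hxb : x ≠ b) (hxb' : x ≠ π b) (hya : y ≠ a) (hya' : y ≠ π a) (hxy : y ≠ x)
    (hxy' : y ≠ π x) :
    7.5 * (c a x + c b y) <
      ∑ u, c a u + ∑ u, c b u - c a b + 6 * m + c (π a) (π x) + c (π b) (π y) := by
  have hinv := B.inv
  have hne := B.ne
  have hxa := B.ne_of_ne_zero hx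
  have hyb := B.ne_of_ne_zero hy
  have I₁ := B.choose hxa.1 hxa.2
  have e1 : cut c π a x b y = c b y := by
    unfold cut; rw [if_neg]; grind
  have hy1 : cut c π a x b y ≠ 0 := by rwa [e1]
  have key := B.lt_two hx hy1
  have hm1 : ∀ u v, cut c π a x u v ≤ m := fun u v => (B.cut_le u v).trans (hm u v)
  have r0 := B.row_sub_le hm hx
  have r1 := I₁.row_sub_le hm1 hy1
  have u1 : upd π a x b = π b := by unfold upd; grind
  have u2 : upd π a x y = π y := by unfold upd; grind
  have d1 := B.row_cut_le_two (a := a) (b := x) (v := b) (x := a) (y := x)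
    hxa.1 (by unfold cut; grind) (by unfold cut; grind)
  have cl := B.cut_le (a := a) (b := x) (π b) (π y)
  have s1 := B.symm a b
  have n1 := B.nonneg b x
  simp only [kill, e1, u1, u2] at key r1 cl
  linarith

/-- Choosing an edge `ax` and then the edge from `b` to `π x`. -/
lemma MinimalBad.lt_pair_opposite (B : MinimalBad π c) {m : ℝ} (hm : ∀ u v, c u v ≤ m)
    {x : V} (hab : a ≠ b) (hab' : π a ≠ b) (hx : c a x ≠ 0) (hy : c b (π x) ≠ 0)
    (hxb : x ≠ b) :
    7.5 * (c a x + c b (π x)) <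
      ∑ u, c a u + ∑ u, c b u - c a b + 6 * m + c (π a) (π b) - c b x - c a (π x) := by
  have hinv := B.inv
  have hne := B.ne
  have hxa := B.ne_of_ne_zero hx
  have hyb := B.ne_of_ne_zero hy
  have I₁ := B.choose hxa.1 hxa.2
  have e1 : cut c π a x b (π x) = c b (π x) := by
    unfold cut; rw [if_neg]; grind
  have hy1 : cut c π a x b (π x) ≠ 0 := by rwa [e1]
  have key := B.lt_two hx hy1
  have r0 := B.row_sub_le hm hx
  have r1 := B.row_sub_le hm hy
  have u1 : upd π a x b = π b := by unfold upd; grind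
  have u2 : upd π a x (π x) = π a := by unfold upd; grind
  have d1 := B.row_cut_le_two (a := a) (b := x) (v := b) (x := a) (y := x)
    hxa.1 (by unfold cut; grind) (by unfold cut; grind)
  have d2 := B.row_cut_le_two (a := a) (b := x) (v := π x) (x := a) (y := π a)
    (hne a).symm (by unfold cut; grind) (by unfold cut; grind)
  have cl := B.cut_le (a := a) (b := x) (π b) (π a)
  have s1 := B.symm a b
  have s2 := B.symm (π b) (π a)
  have s3 := B.symm (π x) (π a)
  have s4 := B.symm (π x) a
  simp only [kill, e1, u1, u2] at key r1 cl
  linarith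

/-- Choosing the edge from `a` to `π b` and then an edge at `b`. -/
lemma MinimalBad.lt_diagonal (B : MinimalBad π c) {m : ℝ} (hm : ∀ u v, c u v ≤ m)
    {y : V} (hx : c a (π b) ≠ 0) (hy : c b y ≠ 0) (hya : y ≠ a)
    (hya' : y ≠ π a) :
    7.5 * (c a (π b) + c b y) <
      ∑ u, c a u + ∑ u, c (π b) u - c a (π b) + (∑ u, c b u - c a b) + 4 * m := by
  have hinv := B.inv
  have hne := B.ne
  have hxa := B.ne_of_ne_zero hx
  have hyb := B.ne_of_ne_zero hy
  have I₁ := B.choose hxa.1 hxa.2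
  have e1 : cut c π a (π b) b y = c b y := by
    unfold cut; rw [if_neg]; grind
  have hy1 : cut c π a (π b) b y ≠ 0 := by rwa [e1]
  have key := B.lt_two hx hy1
  have hm1 : ∀ u v, cut c π a (π b) u v ≤ m := fun u v => (B.cut_le u v).trans (hm u v)
  have r1 := I₁.row_sub_le hm1 hy1
  have d1 := B.row_cut_le_two (a := a) (b := π b) (v := b) (x := a) (y := π a)
    (hne a).symm (by unfold cut; grind) (by unfold cut; grind)
  have cl := hm1 (upd π a (π b) b) (upd π a (π b) y)
  have s1 := B.symm a b
  have s2 := B.symm b (π a)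
  simp only [kill, e1, hinv] at key r1 cl
  linarith

omit [DecidableEq V] in
/-- A row with a large sum has four nonzero entries. -/
lemma Inst.exists_row (H : Inst π c) {m : ℝ} (hm : ∀ u v, c u v ≤ m) {v u : V}
    (hu : c v u ≠ 0) (h : 3 * m < ∑ x, c v x) :
    ∃ x y z, c v x ≠ 0 ∧ c v y ≠ 0 ∧ c v z ≠ 0 ∧ x ≠ u ∧ y ≠ u ∧ z ≠ u ∧ x ≠ y ∧ x ≠ z ∧
      y ≠ z ∧ (∀ w, c v w ≠ 0 → w ≠ u → w = x ∨ w = y ∨ w = z) ∧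
      ∑ x, c v x = c v u + (c v x + c v y + c v z) := by
  classical
  have hm0 : 0 ≤ m := (H.nonneg v u).trans (hm v u)
  set N : Finset V := {x | c v x ≠ 0} with hN
  have hs : ∑ x ∈ N, c v x = ∑ x, c v x := sum_filter_ne_zero univ
  have h4 : #N = 4 := by
    refine le_antisymm (H.deg v) (not_lt.1 fun h3 => ?_)
    have h5 : ∑ x ∈ N, c v x ≤ #N * m := by
      simpa using sum_le_card_nsmul N (c v) m fun x _ => hm v x
    have h6 : (#N : ℝ) ≤ 3 := by exact_mod_cast Nat.lt_succ_iff.1 h3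
    nlinarith
  have huN : u ∈ N := by simpa [hN] using hu
  have h3 : #(N.erase u) = 3 := by rw [card_erase_of_mem huN, h4]
  obtain ⟨x, y, z, hxy, hxz, hyz, hE⟩ := card_eq_three.1 h3
  have hmem : ∀ w, w = x ∨ w = y ∨ w = z → w ≠ u ∧ c v w ≠ 0 := fun w hw => by
    have : w ∈ N.erase u := by rw [hE]; simpa using hw
    simpa [hN] using this
  refine ⟨x, y, z, (hmem x (by simp)).2, (hmem y (by simp)).2, (hmem z (by simp)).2,
    (hmem x (by simp)).1, (hmem y (by simp)).1, (hmem z (by simp)).1, hxy, hxz, hyz,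
    fun w hw hwu => ?_, ?_⟩
  · have : w ∈ N.erase u := by simpa [hN] using ⟨hwu, hw⟩
    rw [hE] at this
    simpa using this
  rw [← hs, ← add_sum_erase N _ huN, hE, sum_insert (by simp [hxy, hxz]), sum_pair hyz, add_assoc]

omit [DecidableEq V] in
lemma Inst.exists_row_two (H : Inst π c) {m : ℝ} (hm : ∀ u v, c u v ≤ m) {v u w : V}
    (hu : c v u ≠ 0) (hw : c v w ≠ 0) (hwu : w ≠ u) (h : 3 * m < ∑ x, c v x) :
    ∃ x y, c v x ≠ 0 ∧ c v y ≠ 0 ∧ x ≠ u ∧ y ≠ u ∧ x ≠ w ∧ y ≠ w ∧ x ≠ y ∧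
      (∀ t, c v t ≠ 0 → t ≠ u → t ≠ w → t = x ∨ t = y) ∧
      ∑ x, c v x = c v u + (c v w + c v x + c v y) := by
  obtain ⟨x, y, z, hx, hy, hz, hxu, hyu, hzu, hxy, hxz, hyz, hall, hs⟩ := H.exists_row hm hu h
  rcases hall w hw hwu with rfl | rfl | rfl
  · exact ⟨y, z, hy, hz, hyu, hzu, hxy.symm, hxz.symm, hyz, by grind, hs⟩
  · exact ⟨x, z, hx, hz, hxu, hzu, hxy, hyz.symm, hxz, by grind, by linarith⟩
  · exact ⟨x, y, hx, hy, hxu, hyu, hxz, hyz, hxy, by grind, by linarith⟩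

lemma MinimalBad.heavy (B : MinimalBad π c) (hab : c a b ≠ 0) (hm : ∀ u v, c u v ≤ c a b) :
    8.5 * c a b < ∑ u, c a u + ∑ u, c b u + c (π a) (π b) ∧ 0 < c a b ∧
      c (π a) (π b) ≠ 0 ∧ 3 * c a b < ∑ u, c a u ∧ 3 * c a b < ∑ u, c b u := by
  have h := B.lt_one hab
  have h0 : 0 < c a b := (B.nonneg a b).lt_of_ne' hab
  have h1 := B.row_le_one hab h0.le fun x _ => hm a x
  have h2 := B.row_le_one (v := b) (u := a) (by rwa [B.symm]) h0.le fun x _ => hm b x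
  have h3 := hm (π a) (π b)
  rw [B.symm b a] at h2
  unfold kill at h
  refine ⟨by linarith, h0, fun h4 => ?_, by linarith, by linarith⟩
  linarith

lemma MinimalBad.far_le (B : MinimalBad π c) (hab : c a b ≠ 0) (hm : ∀ u v, c u v ≤ c a b)
    (ha : c a (π b) = 0) (hb : c b (π a) = 0) :
    ∃ γ, 0 ≤ γ ∧ (∀ z, z ≠ π b → c (π a) z ≤ γ) ∧ (∀ z, z ≠ π a → c (π b) z ≤ γ) ∧
      7 * γ = 2 * (∑ u, c a u + ∑ u, c b u + c (π a) (π b)) - 11 * c a b := by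
  obtain ⟨h85, h0, hf, -, -⟩ := B.heavy hab hm
  have hne := B.ne_of_ne_zero hab
  have hinv := B.inv
  obtain ⟨p, hp, hmax⟩ := exists_max_image
    ({p | (p.1 = π a ∧ p.2 ≠ π b) ∨ (p.1 = π b ∧ p.2 ≠ π a)} : Finset (V × V))
    (fun p => c p.1 p.2) ⟨(π a, π a), by simp; grind⟩
  obtain ⟨s, z⟩ := p
  simp only [mem_filter, mem_univ, true_and] at hp hmax
  have ga : ∀ w, w ≠ π b → c (π a) w ≤ c s z := fun w hw => hmax (π a, w) (.inl ⟨rfl, hw⟩)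
  have gb : ∀ w, w ≠ π a → c (π b) w ≤ c s z := fun w hw => hmax (π b, w) (.inr ⟨rfl, hw⟩)
  suffices hsz : c s z ≤ (2 * (∑ u, c a u + ∑ u, c b u + c (π a) (π b)) - 11 * c a b) / 7 from
    ⟨_, (B.nonneg s z).trans hsz, fun w hw => (ga w hw).trans hsz,
      fun w hw => (gb w hw).trans hsz, by ring⟩
  have s1 := B.symm a b
  have s2 := B.symm (π a) (π b)
  by_cases hz : c s z = 0
  · linarith
  have hz0 := B.nonneg s z
  have z1 := B.part a
  have z2 := B.part b
  rw [B.symm] at z1 z2 ha hb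
  have hza : z ≠ a := by rintro rfl; rcases hp with ⟨rfl, -⟩ | ⟨rfl, -⟩ <;> exact hz ‹_›
  have hzb : z ≠ b := by rintro rfl; rcases hp with ⟨rfl, -⟩ | ⟨rfl, -⟩ <;> exact hz ‹_›
  have rb := B.row_le_one (v := π b) (u := π a) (by rwa [s2] at hf) hz0 gb
  have ra := B.row_le_one hf hz0 ga
  rcases hp with ⟨rfl, hz'⟩ | ⟨rfl, hz'⟩
  · have key := B.lt_extend hm hab hz hza hzb hz'
    have := gb (π z) (by grind)
    have := B.nonneg (π a) b
    linarith
  · have key := B.lt_extend (a := b) (b := a) hm (by rwa [← s1]) hz hzb hza hz'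
    have := ga (π z) (by grind)
    have := B.nonneg (π b) a
    linarith

lemma three_sum_lt {p q : Fin 3 → ℝ} {t : ℝ} {C : Fin 3 → Fin 3 → Prop}
    (hC : ∀ i j k, C i j → C i k → j = k) (hC' : ∀ i j k, C i k → C j k → i = j)
    (h : ∀ i j, ¬ C i j → p i + q j < t) :
    p 0 + p 1 + p 2 + (q 0 + q 1 + q 2) < 3 * t := by
  have h' : ∀ i j, C i j ∨ p i + q j < t := fun i j => or_iff_not_imp_left.2 (h i j)
  have hC0 : ∀ i j k, j ≠ k → ¬ (C i j ∧ C i k) := fun i j k hjk hh => hjk (hC i j k hh.1 hh.2)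
  have hC1 : ∀ i j k, i ≠ j → ¬ (C i k ∧ C j k) := fun i j k hij hh => hij (hC' i j k hh.1 hh.2)
  have a0 := hC0 0 0 1 (by decide)
  have a1 := hC0 0 0 2 (by decide)
  have a2 := hC0 0 1 2 (by decide)
  have a3 := hC0 1 0 1 (by decide)
  have a4 := hC0 1 0 2 (by decide)
  have a5 := hC0 1 1 2 (by decide)
  have a6 := hC0 2 0 1 (by decide)
  have a7 := hC0 2 0 2 (by decide)
  have a8 := hC0 2 1 2 (by decide)
  have b0 := hC1 0 1 0 (by decide)
  have b1 := hC1 0 2 0 (by decide)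
  have b2 := hC1 1 2 0 (by decide)
  have b3 := hC1 0 1 1 (by decide)
  have b4 := hC1 0 2 1 (by decide)
  have b5 := hC1 1 2 1 (by decide)
  have b6 := hC1 0 1 2 (by decide)
  have b7 := hC1 0 2 2 (by decide)
  have b8 := hC1 1 2 2 (by decide)
  have := h' 0 0
  have := h' 0 1
  have := h' 0 2
  have := h' 1 0
  have := h' 1 1
  have := h' 1 2
  have := h' 2 0
  have := h' 2 1
  have := h' 2 2
  clear h h' hC hC' hC0 hC1
  grind

omit [DecidableEq V] [Fintype V] in
lemma exists_of_three {P : V → Prop} {x y z : V} (hxy : x ≠ y) (hxz : x ≠ z) (hyz : y ≠ z)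
    (hx : P x) (hy : P y) (hz : P z) (s t : V) : ∃ w, P w ∧ w ≠ s ∧ w ≠ t := by
  by_contra! h
  have := h x hx
  have := h y hy
  have := h z hz
  by_cases x = s <;> by_cases y = s <;> grind

/-- A heaviest edge `ab` has an edge from `a` to `π b` or from `b` to `π a`. -/
lemma MinimalBad.false_of_parallel (B : MinimalBad π c) (hab : c a b ≠ 0)
    (hm : ∀ u v, c u v ≤ c a b) (ha : c a (π b) = 0) (hb : c b (π a) = 0) : False := by
  obtain ⟨h85, h0, hf, hDa, hDb⟩ := B.heavy hab hm
  obtain ⟨γ, hγ0, ga, gb, hγ⟩ := B.far_le hab hm ha hb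
  obtain ⟨hne, hne'⟩ := B.ne_of_ne_zero hab
  have hinj : Function.Injective π := Function.LeftInverse.injective B.inv
  have hπb : ∀ x, c a x ≠ 0 → x ≠ π b := by rintro x hx rfl; exact hx ha
  have hπa : ∀ y, c b y ≠ 0 → y ≠ π a := by rintro y hy rfl; exact hy hb
  have s1 := B.symm a b
  have s2 := B.symm (π a) (π b)
  have hba : c b a ≠ 0 := by rwa [← s1]
  have ra := B.row_le_one hf hγ0 ga
  have rb := B.row_le_one (v := π b) (u := π a) (by rwa [← s2]) hγ0 gb
  obtain ⟨x₀, x₁, x₂, hx₀, hx₁, hx₂, hxb₀, hxb₁, hxb₂, hx₀₁, hx₀₂, hx₁₂, -, hxs⟩ :=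
    B.exists_row hm hab hDa
  obtain ⟨y₀, y₁, y₂, hy₀, hy₁, hy₂, hya₀, hya₁, hya₂, hy₀₁, hy₀₂, hy₁₂, -, hys⟩ :=
    B.exists_row hm hba hDb
  have hf1 := hm (π a) (π b)
  have mx₀ := hm a x₀
  have mx₁ := hm a x₁
  have mx₂ := hm a x₂
  have my₀ := hm b y₀
  have my₁ := hm b y₁
  have my₂ := hm b y₂
  have triple : ∀ x y, c a x ≠ 0 → c b y ≠ 0 → x ≠ b → y ≠ a → y ≠ x → y ≠ π x →
      7.5 * (c (π a) (π b) + c a x + c b y) <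
        c (π a) (π b) + 6 * γ + ∑ u, c a u + ∑ u, c b u + 6 * c a b - c b x := by
    intro x y hx hy hxb hya hxy hxy'
    have := B.lt_triple hm hne hne' hf hx hy hxb (hπb x hx) hya (hπa y hy) hxy hxy'
    linarith
  have apart : ∀ x, c a x ≠ 0 → x ≠ b → c b x = 0 := by
    intro x hx hxb
    by_contra hbx
    have hxa : x ≠ a := (B.ne_of_ne_zero hx).1.symm
    obtain ⟨y, ⟨hy, hya⟩, hyx, hyx'⟩ := exists_of_three (P := fun y => c b y ≠ 0 ∧ y ≠ a)
      hy₀₁ hy₀₂ hy₁₂ ⟨hy₀, hya₀⟩ ⟨hy₁, hya₁⟩ ⟨hy₂, hya₂⟩ x (π x)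
    have := triple x y hx hy hxb hya hyx hyx'
    have := B.row_le_two hxb.symm hab hx h0.le fun y _ _ => hm a y
    have := B.row_le_three hxa.symm hya.symm hyx.symm hba hbx hy (hm b)
    have := hm a x
    have := hm b x
    linarith
  have pair : ∀ x y, c a x ≠ 0 → c b y ≠ 0 → x ≠ b → y ≠ a →
      7.5 * (c a x + c b y) < ∑ u, c a u + ∑ u, c b u + 5 * c a b + 2 * γ := by
    intro x y hx hy hxb hya
    by_cases hxy : y = π x
    · subst hxy
      have := B.lt_pair_opposite hm hne hne' hx hy hxb
      have := B.nonneg b x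
      have := B.nonneg a (π x)
      linarith
    · have := B.lt_pair hm hne hne' hx hy hxb (hπb x hx) hya (hπa y hy)
        (by rintro rfl; exact hy (apart _ hx hxb)) hxy
      have := ga (π x) (hinj.ne hxb)
      have := gb (π y) (hinj.ne hya)
      linarith
  have hx : ∀ i, c a (![x₀, x₁, x₂] i) ≠ 0 ∧ ![x₀, x₁, x₂] i ≠ b := by
    simpa [Fin.forall_fin_succ] using ⟨⟨hx₀, hxb₀⟩, ⟨hx₁, hxb₁⟩, hx₂, hxb₂⟩
  have hy : ∀ i, c b (![y₀, y₁, y₂] i) ≠ 0 ∧ ![y₀, y₁, y₂] i ≠ a := by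
    simpa [Fin.forall_fin_succ] using ⟨⟨hy₀, hya₀⟩, ⟨hy₁, hya₁⟩, hy₂, hya₂⟩
  have hxi : Function.Injective ![x₀, x₁, x₂] := by
    simp [Function.Injective, Fin.forall_fin_succ, hx₀₁, hx₀₂, hx₁₂, hx₀₁.symm, hx₀₂.symm,
      hx₁₂.symm]
  have hyi : Function.Injective ![y₀, y₁, y₂] := by
    simp [Function.Injective, Fin.forall_fin_succ, hy₀₁, hy₀₂, hy₁₂, hy₀₁.symm, hy₀₂.symm,
      hy₁₂.symm]
  have := three_sum_lt (p := fun i => c a (![x₀, x₁, x₂] i)) (q := fun j => c b (![y₀, y₁, y₂] j))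
    (t := 2 / 15 * (6 * γ + ∑ u, c a u + ∑ u, c b u + 6 * c a b + c (π a) (π b)) - c (π a) (π b))
    (C := fun i j => ![y₀, y₁, y₂] j = π (![x₀, x₁, x₂] i))
    (fun i j k h₁ h₂ => hyi (h₁.trans h₂.symm))
    (fun i j k h₁ h₂ => hxi (hinj (h₁.symm.trans h₂)))
    (fun i j h => by
      have hij : ![y₀, y₁, y₂] j ≠ ![x₀, x₁, x₂] i := fun h' =>
        (hy j).1 (h' ▸ apart _ (hx i).1 (hx i).2)
      have := triple _ _ (hx i).1 (hy j).1 (hx i).2 (hy j).2 hij h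
      have := B.nonneg b (![x₀, x₁, x₂] i)
      linarith)
  have p₀ := pair x₀ y₀ hx₀ hy₀ hxb₀ hya₀
  have p₁ := pair x₁ y₁ hx₁ hy₁ hxb₁ hya₁
  have p₂ := pair x₂ y₂ hx₂ hy₂ hxb₂ hya₂
  change c a x₀ + c a x₁ + c a x₂ + (c b y₀ + c b y₁ + c b y₂) < _ at this
  linarith

/-- A heaviest edge `ab` with an edge from `a` to `π b` has an edge from `b` to `π a`. -/
lemma MinimalBad.false_of_one_diagonal (B : MinimalBad π c) (hab : c a b ≠ 0)
    (hm : ∀ u v, c u v ≤ c a b) (ha : c a (π b) ≠ 0) (hb : c b (π a) = 0) : False := by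
  obtain ⟨h85, h0, hf, hDa, hDb⟩ := B.heavy hab hm
  obtain ⟨hne, hne'⟩ := B.ne_of_ne_zero hab
  have hinj : Function.Injective π := Function.LeftInverse.injective B.inv
  have hπa : ∀ y, c b y ≠ 0 → y ≠ π a := by rintro y hy rfl; exact hy hb
  have s1 := B.symm a b
  have s2 := B.symm (π a) (π b)
  have s3 := B.symm a (π b)
  have hba : c b a ≠ 0 := by rwa [← s1]
  have ra := B.row_le_one hf h0.le fun x _ => hm (π a) x
  have rb := B.row_le_two (v := π b) (B.ne a).symm (by rwa [← s3]) (by rwa [← s2]) h0.le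
    fun x _ _ => hm (π b) x
  obtain ⟨x₀, x₁, hx₀, hx₁, hxb₀, hxb₁, hxb₀', hxb₁', hx₀₁, -, hxs⟩ :=
    B.exists_row_two hm hab ha (B.ne b) hDa
  obtain ⟨y₀, y₁, y₂, hy₀, hy₁, hy₂, hya₀, hya₁, hya₂, hy₀₁, hy₀₂, hy₁₂, -, hys⟩ :=
    B.exists_row hm hba hDb
  have hf1 := hm (π a) (π b)
  have hd1 := hm a (π b)
  have mx₀ := hm a x₀
  have mx₁ := hm a x₁
  have my₀ := hm b y₀
  have my₁ := hm b y₁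
  have my₂ := hm b y₂
  have triple : ∀ y, c b y ≠ 0 → y ≠ a → y ≠ x₀ → y ≠ π x₀ →
      7.5 * (c (π a) (π b) + c a x₀ + c b y) <
        c (π a) (π b) + ∑ u, c a u + ∑ u, c b u + 11 * c a b - c b x₀ := by
    intro y hy hya hxy hxy'
    have := B.lt_triple hm hne hne' hf hx₀ hy hxb₀ hxb₀' hya (hπa y hy) hxy hxy'
    linarith
  have diagonal : ∀ y, c b y ≠ 0 → y ≠ a →
      7.5 * (c a (π b) + c b y) <
        ∑ u, c a u + ∑ u, c b u + c (π a) (π b) + 5 * c a b := by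
    intro y hy hya
    have := B.lt_diagonal hm ha hy hya (hπa y hy)
    linarith
  have apart : c b x₀ = 0 := by
    by_contra hbx
    have hxa : x₀ ≠ a := (B.ne_of_ne_zero hx₀).1.symm
    obtain ⟨y, ⟨hy, hya⟩, hyx, hyx'⟩ := exists_of_three (P := fun y => c b y ≠ 0 ∧ y ≠ a)
      hy₀₁ hy₀₂ hy₁₂ ⟨hy₀, hya₀⟩ ⟨hy₁, hya₁⟩ ⟨hy₂, hya₂⟩ x₀ (π x₀)
    have := triple y hy hya hyx hyx'
    have := B.row_le_two hxb₀.symm hab hx₀ h0.le fun y _ _ => hm a y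
    have := B.row_le_three hxa.symm hya.symm hyx.symm hba hbx hy (hm b)
    have := hm b x₀
    linarith
  have d₀ := diagonal y₀ hy₀ hya₀
  have d₁ := diagonal y₁ hy₁ hya₁
  have d₂ := diagonal y₂ hy₂ hya₂
  have t₀ := triple y₀ hy₀ hya₀ (by rintro rfl; exact hy₀ apart)
  have t₁ := triple y₁ hy₁ hya₁ (by rintro rfl; exact hy₁ apart)
  have t₂ := triple y₂ hy₂ hya₂ (by rintro rfl; exact hy₂ apart)
  by_cases h₀ : y₀ = π x₀
  · have := t₁ (h₀ ▸ hy₀₁.symm)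
    have := t₂ (h₀ ▸ hy₀₂.symm)
    linarith
  · have := t₀ h₀
    by_cases h₁ : y₁ = π x₀
    · have := t₂ (h₁ ▸ hy₁₂.symm)
      linarith
    · have := t₁ h₁
      linarith

omit [DecidableEq V] [Fintype V] in
lemma eq_of_covered (hπ : ∀ v, π (π v) = v) {x₀ x₁ y₀ y₁ : V} (hx : x₀ ≠ x₁) (hy : y₀ ≠ y₁)
    (h₀₀ : y₀ = x₀ ∨ y₀ = π x₀) (h₀₁ : y₁ = x₀ ∨ y₁ = π x₀) (h₁₀ : y₀ = x₁ ∨ y₀ = π x₁) :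
    x₁ = π x₀ ∧ ((y₀ = x₀ ∧ y₁ = π x₀) ∨ (y₀ = π x₀ ∧ y₁ = x₀)) := by
  have := hπ x₀
  have := hπ x₁
  grind

/-- There is at most one edge between `{a, π a}` and `{b, π b}` besides `ab` and `π a π b`
when `ab` is a heaviest edge. -/
lemma MinimalBad.false_of_two_diagonals (B : MinimalBad π c) (hab : c a b ≠ 0)
    (hm : ∀ u v, c u v ≤ c a b) (ha : c a (π b) ≠ 0) (hb : c b (π a) ≠ 0) : False := by
  obtain ⟨h85, h0, hf, hDa, hDb⟩ := B.heavy hab hm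
  obtain ⟨hne, hne'⟩ := B.ne_of_ne_zero hab
  have s1 := B.symm a b
  have s2 := B.symm (π a) (π b)
  have s3 := B.symm a (π b)
  have s4 := B.symm b (π a)
  have hba : c b a ≠ 0 := by rwa [← s1]
  have ra := B.row_le_two (v := π a) (B.ne b).symm (by rwa [← s4]) hf h0.le
    fun x _ _ => hm (π a) x
  have rb := B.row_le_two (v := π b) (B.ne a).symm (by rwa [← s3]) (by rwa [← s2]) h0.le
    fun x _ _ => hm (π b) x
  obtain ⟨x₀, x₁, hx₀, hx₁, hxb₀, hxb₁, hxb₀', hxb₁', hx₀₁, -, hxs⟩ :=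
    B.exists_row_two hm hab ha (B.ne b) hDa
  obtain ⟨y₀, y₁, hy₀, hy₁, hya₀, hya₁, hya₀', hya₁', hy₀₁, -, hys⟩ :=
    B.exists_row_two hm hba hb (B.ne a) hDb
  have hf1 := hm (π a) (π b)
  have hd1 := hm a (π b)
  have hd2 := hm b (π a)
  have mx₀ := hm a x₀
  have mx₁ := hm a x₁
  have my₀ := hm b y₀
  have my₁ := hm b y₁
  have triple : ∀ x y, c a x ≠ 0 → c b y ≠ 0 → x ≠ b → x ≠ π b → y ≠ a → y ≠ π a →
      y = x ∨ y = π x := by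
    intro x y hx hy hxb hxb' hya hya'
    by_contra! h
    obtain ⟨hxy, hxy'⟩ := h
    have := B.lt_triple hm hne hne' hf hx hy hxb hxb' hya hya' hxy hxy'
    have := B.row_le_three hxb.symm (B.ne b).symm hxb' hab hx ha (hm a)
    have := B.row_le_three hya.symm (B.ne a).symm hya' hba hy hb (hm b)
    have := hm a x
    have := hm b y
    have := B.nonneg b x
    linarith
  obtain ⟨rfl, hxy⟩ := eq_of_covered B.inv hx₀₁ hy₀₁
    (triple x₀ y₀ hx₀ hy₀ hxb₀ hxb₀' hya₀ hya₀')
    (triple x₀ y₁ hx₀ hy₁ hxb₀ hxb₀' hya₁ hya₁')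
    (triple x₁ y₀ hx₁ hy₀ hxb₁ hxb₁' hya₀ hya₀')
  have hbx : c b x₀ ≠ 0 ∧ c b (π x₀) ≠ 0 ∧
      ∑ u, c b u = c b a + (c b (π a) + c b x₀ + c b (π x₀)) := by
    rcases hxy with ⟨rfl, rfl⟩ | ⟨rfl, rfl⟩
    · exact ⟨hy₀, hy₁, hys⟩
    · exact ⟨hy₁, hy₀, by linarith⟩
  have p₀ := B.lt_pair_opposite hm hne hne' hx₀ hbx.2.1 hxb₀
  have p₁ := B.lt_pair_opposite hm hne hne' hx₁ (by rw [B.inv]; exact hbx.1) hxb₁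
  rw [B.inv] at p₁
  linarith [hbx.2.2]

lemma MinimalBad.false (B : MinimalBad π c) : False := by
  have hV : Nonempty V := by
    by_contra! h
    exact B.bad ⟨[], .nil π, by simp, by simp⟩
  obtain ⟨p, -, hp⟩ := exists_max_image (univ : Finset (V × V)) (fun p => c p.1 p.2)
    (univ_nonempty)
  obtain ⟨a, b⟩ := p
  have hm : ∀ u v, c u v ≤ c a b := fun u v => hp (u, v) (mem_univ _)
  by_cases hab : c a b = 0
  · refine B.bad ⟨[], .nil π, by simp, ?_⟩
    have : ∑ u, ∑ v, c u v ≤ 0 :=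
      sum_nonpos fun u _ => sum_nonpos fun v _ => (hm u v).trans hab.le
    simp only [List.map_nil, List.sum_nil]
    linarith
  have hba : c b a = c a b := B.symm b a
  by_cases ha : c a (π b) = 0 <;> by_cases hb : c b (π a) = 0
  · exact B.false_of_parallel hab hm ha hb
  · exact B.false_of_one_diagonal (a := b) (b := a) (hba ▸ hab) (hba ▸ hm) hb ha
  · exact B.false_of_one_diagonal hab hm ha hb
  · exact B.false_of_two_diagonals hab hm ha hb

/-- Every instance attains a fifteenth of its entry sum. -/
theorem Inst.attains (H : Inst π c) : Attains π c ((∑ u, ∑ v, c u v) / 15) := by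
  induction h : #{p : V × V | c p.1 p.2 ≠ 0} using Nat.strong_induction_on generalizing π c with
  | _ n ih =>
    by_contra hbad
    exact MinimalBad.false ⟨H, fun π' c' H' hlt => ih _ (h ▸ hlt) H' rfl, hbad⟩

end

section
variable {V : Type*} [DecidableEq V] {π : V → V}

lemma exists_involution_of_isPerfectMatchingSet {M : Finset (Sym2 V)}
    (hM : IsPerfectMatchingSet M) :
    ∃ π : V → V, (∀ v, π (π v) = v) ∧ (∀ v, π v ≠ v) ∧ ∀ u v, s(u, v) ∈ M ↔ v = π u := by
  have h : ∀ v, ∃ u, s(v, u) ∈ M := by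
    intro v
    obtain ⟨e, he, u, rfl⟩ := hM.2 v
    exact ⟨u, he⟩
  choose π hπ using h
  have hu : ∀ u v, s(u, v) ∈ M ↔ v = π u := by
    refine fun u v => ⟨fun huv => ?_, fun huv => huv ▸ hπ u⟩
    by_contra hne
    exact hM.1.2 _ huv _ (hπ u) (fun h => hne (Sym2.congr_right.1 h)) u
      (Sym2.mem_mk_left _ _) (Sym2.mem_mk_left _ _)
  refine ⟨π, fun v => ?_, fun v hv => ?_, hu⟩
  · exact ((hu _ _).1 (Sym2.eq_swap ▸ hπ v)).symm
  · exact hM.1.1 _ (hπ v) (by simp [hv])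

lemma Inst.of_isTwoMatchingSet [Fintype V] {C₁ C₂ : Finset (Sym2 V)} {w : Sym2 V → ℝ}
    (hw : ∀ e, 0 ≤ w e) (hC₁ : IsTwoMatchingSet C₁) (hC₂ : IsTwoMatchingSet C₂)
    (hinv : ∀ v, π (π v) = v) (hne : ∀ v, π v ≠ v) (hπ : ∀ v, s(v, π v) ∉ C₁ ∪ C₂) :
    Inst π fun u v => if s(u, v) ∈ C₁ ∪ C₂ then w s(u, v) else 0 where
  inv := hinv
  ne := hne
  symm u v := by simp only [Sym2.eq_swap]
  nonneg u v := by
    split_ifs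
    exacts [hw _, le_rfl]
  diag v := if_neg fun h => (mem_union.1 h).elim
    (fun h => hC₁.1 _ h (Sym2.mk_isDiag_iff.2 rfl)) (fun h => hC₂.1 _ h (Sym2.mk_isDiag_iff.2 rfl))
  part v := if_neg (hπ v)
  deg v := by
    have hcard : #((C₁ ∪ C₂).filter (v ∈ ·)) ≤ 4 := by
      rw [filter_union]
      have h1 := hC₁.2 v
      have h2 := hC₂.2 v
      exact (card_union_le _ _).trans (by omega)
    refine (card_le_card_of_injOn (fun u => s(v, u)) (fun u hu => ?_) ?_).trans hcard
    · simp only [coe_filter, mem_univ, true_and, Set.mem_ofPred_eq] at hu ⊢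
      exact ⟨by_contra fun h => hu (if_neg h), Sym2.mem_mk_left _ _⟩
    · exact fun _ _ _ _ h => Sym2.congr_right.1 h

lemma two_mul_sum_le_sum_sum [Fintype V] {C : Finset (Sym2 V)} {w : Sym2 V → ℝ}
    (hw : ∀ e, 0 ≤ w e) (hC : ∀ e ∈ C, ¬ e.IsDiag) :
    2 * ∑ e ∈ C, w e ≤ ∑ u, ∑ v, if s(u, v) ∈ C then w s(u, v) else 0 := by
  have h : ∑ e ∈ C, ∑ p : V × V with s(p.1, p.2) = e, w s(p.1, p.2)
      = ∑ u, ∑ v, if s(u, v) ∈ C then w s(u, v) else 0 := by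
    rw [← Fintype.sum_prod_type' (f := fun u v => if s(u, v) ∈ C then w s(u, v) else 0),
      ← sum_filter, ← sum_fiberwise_of_maps_to (t := C) (g := fun p : V × V => s(p.1, p.2))
        (fun p hp => (mem_filter.1 hp).2)]
    refine sum_congr rfl fun e he => sum_congr ?_ fun _ _ => rfl
    ext p
    simp only [mem_filter, mem_univ, true_and]
    exact ⟨fun h => ⟨h ▸ he, h⟩, fun h => h.2⟩
  rw [← h, mul_sum]
  refine sum_le_sum fun e he => ?_
  induction e with | _ a b
  have hab : a ≠ b := fun h => hC _ he (Sym2.mk_isDiag_iff.2 h)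
  calc 2 * w s(a, b) = ∑ p ∈ {(a, b), (b, a)}, w s(p.1, p.2) := by
        rw [sum_pair (by simp [hab]), Sym2.eq_swap (a := b)]
        ring
    _ ≤ _ := by
        refine sum_le_sum_of_subset_of_nonneg (fun p hp => ?_) fun _ _ _ => hw _
        simp only [mem_insert, mem_singleton] at hp
        rcases hp with rfl | rfl <;> simp

lemma Picks.pairwise {l : List (V × V)} (h : Picks π l) :
    l.Pairwise fun p q => ∀ v, v ∈ s(p.1, p.2) → v ∉ s(q.1, q.2) := by
  induction h with
  | nil => exact .nil
  | cons π a b l hab hπ hl h ih =>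
    refine .cons (fun q hq v hv hv' => ?_) ih
    have := hl q hq
    simp only [Sym2.mem_iff] at hv hv'
    grind

lemma Picks.ne {l : List (V × V)} (h : Picks π l) : ∀ p ∈ l, p.1 ≠ p.2 := by
  induction h with
  | nil => simp
  | cons π a b l hab hπ hl h ih => simpa [hab] using ih

lemma Picks.nodup {l : List (V × V)} (h : Picks π l) :
    (l.map fun p => s(p.1, p.2)).Nodup :=
  List.pairwise_map.2 <| h.pairwise.imp fun {p _} hpq heq =>
    hpq p.1 (Sym2.mem_mk_left _ _) ((congrArg (p.1 ∈ ·) heq).mp (Sym2.mem_mk_left _ _))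

lemma Picks.isMatchingSet {l : List (V × V)} (h : Picks π l) :
    IsMatchingSet (l.map fun p => s(p.1, p.2)).toFinset := by
  refine ⟨fun e he => ?_, fun e he f hf hef => ?_⟩
  · simp only [List.mem_toFinset, List.mem_map] at he
    obtain ⟨p, hp, rfl⟩ := he
    exact fun hd => h.ne p hp (Sym2.mk_isDiag_iff.1 hd)
  · simp only [List.mem_toFinset] at he hf
    have hpw : (l.map fun p => s(p.1, p.2)).Pairwise fun e f => ∀ v, v ∈ e → v ∉ f :=
      List.pairwise_map.2 h.pairwise
    have : Std.Symm fun e f : Sym2 V => ∀ v, v ∈ e → v ∉ f := ⟨fun _ _ h v hv hv' => h v hv' hv⟩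
    exact hpw.forall he hf hef

lemma IsMatchingSet.card_filter_mem_le_one {M : Finset (Sym2 V)} (hM : IsMatchingSet M) (v : V) :
    #(M.filter (v ∈ ·)) ≤ 1 := by
  refine card_le_one.2 fun e he f hf => by_contra fun hef => ?_
  rw [mem_filter] at he hf
  exact hM.2 e he.1 f hf.1 hef v he.2 hf.2

lemma IsMatchingSet.isTwoMatchingSet_union {M N : Finset (Sym2 V)} (hM : IsMatchingSet M)
    (hN : IsMatchingSet N) : IsTwoMatchingSet (M ∪ N) := by
  refine ⟨fun e he => (mem_union.1 he).elim (hM.1 e) (hN.1 e), fun v => ?_⟩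
  rw [filter_union]
  exact (card_union_le _ _).trans
    (add_le_add (hM.card_filter_mem_le_one v) (hN.card_filter_mem_le_one v))

omit [DecidableEq V] in
lemma SimpleGraph.Reachable.of_sup_edge {P : SimpleGraph V} {a b u v : V}
    (h : (P ⊔ SimpleGraph.edge a b).Reachable u v) :
    P.Reachable u v ∨ (P.Reachable u a ∧ P.Reachable b v) ∨
      (P.Reachable u b ∧ P.Reachable a v) := by
  obtain ⟨p⟩ := h
  induction p with
  | nil => exact .inl .rfl
  | cons hadj p ih =>
    rw [SimpleGraph.sup_adj, SimpleGraph.edge_adj] at hadj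
    rcases hadj with hadj | ⟨⟨rfl, rfl⟩ | ⟨rfl, rfl⟩, -⟩
    · have := hadj.reachable
      rcases ih with ih | ⟨ih, ih'⟩ | ⟨ih, ih'⟩
      · exact .inl (this.trans ih)
      · exact .inr (.inl ⟨this.trans ih, ih'⟩)
      · exact .inr (.inr ⟨this.trans ih, ih'⟩)
    · rcases ih with ih | ⟨-, ih⟩ | ⟨-, ih⟩
      · exact .inr (.inl ⟨.rfl, ih⟩)
      · exact .inr (.inl ⟨.rfl, ih⟩)
      · exact .inl ih
    · rcases ih with ih | ⟨-, ih⟩ | ⟨-, ih⟩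
      · exact .inr (.inr ⟨.rfl, ih⟩)
      · exact .inl ih
      · exact .inr (.inr ⟨.rfl, ih⟩)

/-- If the components of the forest `P` meet the set `L` of available vertices in pairs
matched by `π`, then adding the chosen edges does not create cycles. -/
lemma Picks.isAcyclic {l : List (V × V)} (h : Picks π l) (hinv : ∀ v, π (π v) = v)
    (hne : ∀ v, π v ≠ v) (P : SimpleGraph V) (hP : P.IsAcyclic) (L : Set V)
    (hL : ∀ u ∈ L, ∀ v ∈ L, P.Reachable u v → v = u ∨ v = π u)
    (hl : ∀ p ∈ l, p.1 ∈ L ∧ p.2 ∈ L) :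
    (P ⊔ SimpleGraph.fromEdgeSet {e | ∃ p ∈ l, s(p.1, p.2) = e}).IsAcyclic := by
  induction h generalizing P L with
  | nil => simpa using hP
  | cons π a b l hab hπ hd h ih =>
    have hab' := hl (a, b) List.mem_cons_self
    have hset : {e | ∃ p ∈ (a, b) :: l, s(p.1, p.2) = e}
        = {s(a, b)} ∪ {e | ∃ p ∈ l, s(p.1, p.2) = e} := by
      ext e
      simp [eq_comm]
    rw [hset, SimpleGraph.fromEdgeSet_union, ← sup_assoc]
    refine ih (upd_upd hinv hne hab hπ) (upd_ne hinv hne hab) (P ⊔ SimpleGraph.edge a b)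
      (hP.sup_edge_of_not_reachable fun hr => ?_) (L \ {a, b}) (fun u hu v hv hr => ?_)
      fun p hp => ?_
    · rcases hL a hab'.1 b hab'.2 hr with h | h
      exacts [hab h.symm, hπ h.symm]
    · obtain ⟨hu, hu'⟩ := hu
      obtain ⟨hv, hv'⟩ := hv
      simp only [Set.mem_insert_iff, Set.mem_singleton_iff, not_or] at hu' hv'
      have key : ∀ x y : V, x ∈ L → y ∈ L → P.Reachable x y → y = x ∨ y = π x :=
        fun x y hx hy => hL x hx y hy
      unfold upd
      rcases hr.of_sup_edge with hr | ⟨hr, hr'⟩ | ⟨hr, hr'⟩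
      · have := hL u hu v hv hr
        grind
      · have h1 := hL a hab'.1 u hu hr.symm
        have h2 := hL b hab'.2 v hv hr'
        grind
      · have h1 := hL b hab'.2 u hu hr.symm
        have h2 := hL a hab'.1 v hv hr'
        grind
    · have h1 := hl p (List.mem_cons_of_mem _ hp)
      have h2 := hd p hp
      simp only [Set.mem_sdiff, Set.mem_insert_iff, Set.mem_singleton_iff]
      tauto

omit [DecidableEq V] in
lemma SimpleGraph.isAcyclic_of_adj_iff_eq {P : SimpleGraph V}
    (hP : ∀ u v, P.Adj u v ↔ v = π u) : P.IsAcyclic := by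
  rw [SimpleGraph.isAcyclic_iff_forall_adj_isBridge]
  intro v u hvu
  rw [SimpleGraph.isBridge_iff]
  rintro ⟨p⟩
  cases p with
  | nil => exact P.loopless.irrefl _ hvu
  | cons h p =>
    rw [SimpleGraph.deleteEdges_adj, hP] at h
    rw [hP] at hvu
    exact h.2 (by simp [h.1, hvu])

omit [DecidableEq V] in
lemma SimpleGraph.Reachable.eq_or_eq_involution {P : SimpleGraph V} (hinv : ∀ v, π (π v) = v)
    (hP : ∀ u v, P.Adj u v ↔ v = π u) {u v : V} (h : P.Reachable u v) : v = u ∨ v = π u := by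
  obtain ⟨p⟩ := h
  induction p with
  | nil => exact .inl rfl
  | cons h p ih =>
    rw [hP] at h
    subst h
    rw [hinv] at ih
    exact ih.symm

end

end

/-- If `M1` is a perfect matching of a finite edge-weighted simple graph `G`
on an even number of vertices (with nonnegative edge weights) and `C1`, `C2` are two
mutually edge-disjoint 2-matchings of `G`, each sharing no edge with `M1`, then there is
a matching `M2 ⊆ C1 ∪ C2` such that `M1 ∪ M2` is an acyclic 2-matching of `G` and the
weight of `M2` is at least `2/15 = 1/7.5` of the total weight of `C1` and `C2`. -/
theorem stmt8 {V : Type*} [Fintype V] [DecidableEq V]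
    (hV : Even (Fintype.card V)) (G : SimpleGraph V)
    (w : Sym2 V → ℝ) (hw : ∀ e, 0 ≤ w e)
    (M1 : Finset (Sym2 V)) (hM1 : IsPerfectMatchingSet M1)
    (hM1G : (↑M1 : Set (Sym2 V)) ⊆ G.edgeSet)
    (C1 C2 : Finset (Sym2 V))
    (hC1 : IsTwoMatchingSet C1) (hC1G : (↑C1 : Set (Sym2 V)) ⊆ G.edgeSet)
    (hC2 : IsTwoMatchingSet C2) (hC2G : (↑C2 : Set (Sym2 V)) ⊆ G.edgeSet)
    (hC1C2 : Disjoint C1 C2)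
    (hM1C1 : Disjoint M1 C1) (hM1C2 : Disjoint M1 C2) :
    ∃ M2 ⊆ C1 ∪ C2, IsMatchingSet M2 ∧
      (↑(M1 ∪ M2) : Set (Sym2 V)) ⊆ G.edgeSet ∧
      IsAcyclicTwoMatchingSet (M1 ∪ M2) ∧
      (2 / 15 : ℝ) * (∑ e ∈ C1, w e + ∑ e ∈ C2, w e) ≤ ∑ e ∈ M2, w e := by
  obtain ⟨π, hinv, hne, hπ⟩ := exists_involution_of_isPerfectMatchingSet hM1
  have hMC : Disjoint M1 (C1 ∪ C2) := Finset.disjoint_union_right.2 ⟨hM1C1, hM1C2⟩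
  have H := Inst.of_isTwoMatchingSet hw hC1 hC2 hinv hne
    fun v => Finset.disjoint_left.1 hMC ((hπ v _).2 rfl)
  obtain ⟨l, hl, hc, hs⟩ := H.attains
  replace hc : ∀ p ∈ l, s(p.1, p.2) ∈ C1 ∪ C2 := fun p hp => by_contra fun h => hc p hp (if_neg h)
  have hM2 := hl.isMatchingSet
  have hsub : (l.map fun p => s(p.1, p.2)).toFinset ⊆ C1 ∪ C2 := by
    intro e he
    simp only [List.mem_toFinset, List.mem_map] at he
    obtain ⟨p, hp, rfl⟩ := he
    exact hc p hp
  have hdiag : ∀ e ∈ C1 ∪ C2, ¬ e.IsDiag :=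
    fun e he => (Finset.mem_union.1 he).elim (hC1.1 e) (hC2.1 e)
  refine ⟨_, hsub, hM2, ?_, ⟨hM1.1.isTwoMatchingSet_union hM2, ?_⟩, ?_⟩
  · intro e he
    rcases Finset.mem_union.1 (Finset.mem_coe.1 he) with he | he
    · exact hM1G he
    · exact (Finset.mem_union.1 (hsub he)).elim (fun h => hC1G h) fun h => hC2G h
  · have hadj : ∀ u v, (SimpleGraph.fromEdgeSet (↑M1 : Set (Sym2 V))).Adj u v ↔ v = π u := by
      intro u v
      rw [SimpleGraph.fromEdgeSet_adj, Finset.mem_coe, hπ]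
      exact ⟨fun h => h.1, fun h => ⟨h, fun huv => hne u (h ▸ huv.symm)⟩⟩
    have := hl.isAcyclic hinv hne _ (SimpleGraph.isAcyclic_of_adj_iff_eq hadj)
      Set.univ (fun u _ v _ h => h.eq_or_eq_involution hinv hadj) (by simp)
    convert this using 1
    rw [Finset.coe_union, SimpleGraph.fromEdgeSet_union]
    congr 1
    ext e
    simp
  · rw [List.sum_toFinset _ hl.nodup, List.map_map]
    rw [List.map_congr_left fun p hp => if_pos (hc p hp)] at hs
    have h := two_mul_sum_le_sum_sum hw hdiag
    rw [Finset.sum_union hC1C2] at h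
    refine le_trans ?_ hs
    linarith
end

section
/- Let M and Y be two edge-disjoint matchings in a finite simple graph G. Then Y can be partitioned into two matchings X2 and X3 such that both the graph with edge set M ∪ X2 and the graph with edge set M ∪ X3 are acyclic (each is a vertex-disjoint union of paths). -/
/-- Every edge of a cycle has, at each of its ends, a further edge of the cycle. -/
theorem SimpleGraph.Walk.IsCycle.exists_ne_mem_edges {V : Type*} {H : SimpleGraph V} {a : V}
    {c : H.Walk a a} (hc : c.IsCycle) {v w : V} (h : s(v, w) ∈ c.edges) :
    ∃ x, x ≠ w ∧ s(v, x) ∈ c.edges := by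
  have h2 := hc.ncard_neighborSet_toSubgraph_eq_two (c.fst_mem_support_of_mem_edges h)
  obtain ⟨x, hx, hne⟩ := Set.exists_ne_of_one_lt_ncard (h2 ▸ Nat.one_lt_two) w
  exact ⟨x, hne, SimpleGraph.Walk.adj_toSubgraph_iff_mem_edges.mp hx⟩

/-- Two edges of a matching at a common vertex have the same other end. -/
theorem IsMatchingSet.eq_of_mem {V : Type*} {M : Finset (Sym2 V)} (hM : IsMatchingSet M)
    {v x y : V} (hx : s(v, x) ∈ M) (hy : s(v, y) ∈ M) : x = y := by
  by_contra hne
  exact hM.2 _ hx _ hy (fun h => hne (Sym2.congr_right.mp h)) v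
    (Sym2.mem_mk_left v x) (Sym2.mem_mk_left v y)

theorem IsMatchingSet.subset {V : Type*} {M N : Finset (Sym2 V)} (hM : IsMatchingSet M)
    (h : N ⊆ M) : IsMatchingSet N :=
  ⟨fun e he => hM.1 e (h he), fun e he f hf => hM.2 e (h he) f (h hf)⟩

theorem SimpleGraph.Walk.mem_of_mem_edges_fromEdgeSet {V : Type*} {S : Finset (Sym2 V)} {a b : V}
    {p : (SimpleGraph.fromEdgeSet (S : Set (Sym2 V))).Walk a b} {e : Sym2 V}
    (he : e ∈ p.edges) : e ∈ S := by
  have := p.edges_subset_edgeSet he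
  rw [SimpleGraph.edgeSet_fromEdgeSet] at this
  exact this.1

/-- A cycle in the union of a matching and a set `X` uses an edge of `X`. -/
theorem IsMatchingSet.exists_mem_edges_of_isCycle {V : Type*} [DecidableEq V]
    {M X : Finset (Sym2 V)} (hM : IsMatchingSet M) {a : V}
    {c : (SimpleGraph.fromEdgeSet (↑(M ∪ X) : Set (Sym2 V))).Walk a a} (hc : c.IsCycle) :
    ∃ u v, s(u, v) ∈ X ∧ s(u, v) ∈ c.edges := by
  obtain ⟨e, he⟩ := List.exists_mem_of_ne_nil c.edges
    (fun h => hc.not_nil (SimpleGraph.Walk.edges_eq_nil.mp h))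
  induction e using Sym2.ind with | _ v w
  obtain ⟨x, hne, hx⟩ := hc.exists_ne_mem_edges he
  rcases Finset.mem_union.mp (SimpleGraph.Walk.mem_of_mem_edges_fromEdgeSet he) with h | h
  · rcases Finset.mem_union.mp (SimpleGraph.Walk.mem_of_mem_edges_fromEdgeSet hx) with h' | h'
    · exact absurd (hM.eq_of_mem h' h) hne
    · exact ⟨v, x, h', hx⟩
  · exact ⟨v, w, h, he⟩

/-- From a `Y`-edge `s(u, v)` on a cycle in the union of disjoint matchings `M` and `X ⊆ Y`, the
cycle continues along the `M`-edge at `v` and then along an edge of `X`. -/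
theorem IsMatchingSet.exists_alternating_of_isCycle {V : Type*} [DecidableEq V]
    {M X Y : Finset (Sym2 V)} (hM : IsMatchingSet M) (hY : IsMatchingSet Y) (hXY : X ⊆ Y) {a : V}
    {c : (SimpleGraph.fromEdgeSet (↑(M ∪ X) : Set (Sym2 V))).Walk a a} (hc : c.IsCycle)
    {u v : V} (he : s(v, u) ∈ c.edges) (heY : s(v, u) ∈ Y) :
    ∃ w x, s(v, w) ∈ M ∧ s(w, x) ∈ X := by
  obtain ⟨w, hwu, hw⟩ := hc.exists_ne_mem_edges he
  have hwM : s(v, w) ∈ M := by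
    rcases Finset.mem_union.mp (SimpleGraph.Walk.mem_of_mem_edges_fromEdgeSet hw) with h | h
    · exact h
    · exact absurd (hY.eq_of_mem (hXY h) heY) hwu
  rw [Sym2.eq_swap] at hw
  obtain ⟨x, hxv, hx⟩ := hc.exists_ne_mem_edges hw
  refine ⟨w, x, hwM, ?_⟩
  rcases Finset.mem_union.mp (SimpleGraph.Walk.mem_of_mem_edges_fromEdgeSet hx) with h | h
  · exact absurd (hM.eq_of_mem h (Sym2.eq_swap ▸ hwM)) hxv
  · exact h

/-- If `M` and `Y` are two edge-disjoint matchings in a finite simple graph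
`G`, then `Y` can be partitioned into two matchings `X2` and `X3` such that both the
graph with edge set `M ∪ X2` and the graph with edge set `M ∪ X3` are acyclic. -/
theorem stmt9 {V : Type*} [Fintype V] [DecidableEq V]
    (G : SimpleGraph V)
    (M Y : Finset (Sym2 V)) (hM : IsMatchingSet M) (hY : IsMatchingSet Y)
    (hMG : (↑M : Set (Sym2 V)) ⊆ G.edgeSet) (hYG : (↑Y : Set (Sym2 V)) ⊆ G.edgeSet)
    (hdisj : Disjoint M Y) :
    ∃ X2 X3 : Finset (Sym2 V),
      Disjoint X2 X3 ∧ X2 ∪ X3 = Y ∧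
      IsMatchingSet X2 ∧ IsMatchingSet X3 ∧
      (SimpleGraph.fromEdgeSet (↑(M ∪ X2) : Set (Sym2 V))).IsAcyclic ∧
      (SimpleGraph.fromEdgeSet (↑(M ∪ X3) : Set (Sym2 V))).IsAcyclic := by
  classical
  obtain ⟨X, hX⟩ := (Y.powerset.filter fun X =>
    (SimpleGraph.fromEdgeSet (↑(M ∪ X) : Set (Sym2 V))).IsAcyclic).exists_maximal
      ⟨∅, by
        simp only [Finset.mem_filter, Finset.empty_mem_powerset, true_and]
        intro a c hc
        obtain ⟨u, v, h, -⟩ := hM.exists_mem_edges_of_isCycle hc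
        simp at h⟩
  obtain ⟨hXY, hXac⟩ : X ⊆ Y ∧ _ := by
    simpa only [Finset.mem_filter, Finset.mem_powerset] using hX.prop
  refine ⟨X, Y \ X, Finset.disjoint_sdiff, Finset.union_sdiff_of_subset hXY, hY.subset hXY,
    hY.subset Finset.sdiff_subset, hXac, ?_⟩
  intro a c hc
  obtain ⟨u, v, huv, huvc⟩ := hM.exists_mem_edges_of_isCycle hc
  obtain ⟨heY, heX⟩ := Finset.mem_sdiff.mp huv
  have hXY' : insert s(u, v) X ⊆ Y := Finset.insert_subset heY hXY
  have hcyc : ¬ (SimpleGraph.fromEdgeSet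
      (↑(M ∪ insert s(u, v) X) : Set (Sym2 V))).IsAcyclic := fun h =>
    heX (hX.le_of_ge (Finset.mem_filter.mpr ⟨Finset.mem_powerset.mpr hXY', h⟩)
      (Finset.subset_insert _ _) (Finset.mem_insert_self _ _))
  simp only [SimpleGraph.IsAcyclic, not_forall, not_not] at hcyc
  obtain ⟨b, c', hc'⟩ := hcyc
  have huvc' : s(u, v) ∈ c'.edges := by
    by_contra hnot
    refine hXac _ (hc'.transfer (fun e he => ?_))
    have hmem := SimpleGraph.Walk.mem_of_mem_edges_fromEdgeSet he
    rw [SimpleGraph.edgeSet_fromEdgeSet]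
    refine ⟨?_, SimpleGraph.not_isDiag_of_mem_edgeSet _ (c'.edges_subset_edgeSet he)⟩
    have hne : e ≠ s(u, v) := fun h => hnot (h ▸ he)
    simpa [hne] using hmem
  obtain ⟨w, x, hw, hx⟩ := hM.exists_alternating_of_isCycle hY Finset.sdiff_subset hc huvc heY
  obtain ⟨w', x', hw', hx'⟩ := hM.exists_alternating_of_isCycle hY hXY' hc' huvc' heY
  obtain rfl := hM.eq_of_mem hw hw'
  obtain rfl := hY.eq_of_mem (Finset.sdiff_subset hx) (hXY' hx')
  rcases Finset.mem_insert.mp hx' with h | h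
  · have hmem : w = u ∨ w = v := Sym2.mem_iff.mp (h ▸ Sym2.mem_mk_left w x)
    rcases hmem with rfl | rfl
    · exact hM.1 _ hw rfl
    · exact Finset.disjoint_left.mp hdisj hw heY
  · exact (Finset.mem_sdiff.mp hx).2 h
end
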